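/- arXiv:1402.6924 — 2 statements merged into one kernel-verified Lean document; each statement's English description precedes it below -/
import Mathlib

section
/- Let n ≥ 1 and let r ≥ 0 be odd. For every k ≥ 0, the dimension of the real vector space C^r_k(AS(Δ_n)) of splines of smoothness r and degree at most k on the Alfeld split of the n-simplex is binom(k+n, n) + n · binom(k + n − (r+1)(n+1)/2, n), with the convention that binom(a, n) = 0 whenever a < n. -/
open MvPolynomial

noncomputable section

/-- The `i`-th maximal simplex `σ_i = conv({v} ∪ {e_j : j ≠ i})` of the Alfeld split
`AS(Δ_n)` of the simplex `Δ_n = conv{e_0, …, e_n}` with interior split point `v`. -/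
def alfeldCell {n : ℕ} (e : Fin (n + 1) → Fin n → ℝ) (v : Fin n → ℝ) (i : Fin (n + 1)) :
    Set (Fin n → ℝ) :=
  convexHull ℝ ({v} ∪ e '' {j | j ≠ i})

/-- The space `C^r_k(AS(Δ_n))` of splines on the Alfeld split: functions on
`Δ_n = conv{e_0, …, e_n}` that are `r` times continuously differentiable on `Δ_n` and agree on
each maximal simplex `σ_i` with a polynomial of total degree at most `k`. -/
def alfeldSplines (n r k : ℕ) (e : Fin (n + 1) → Fin n → ℝ) (v : Fin n → ℝ) :
    Submodule ℝ ((convexHull ℝ (Set.range e) : Set (Fin n → ℝ)) → ℝ) where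
  carrier := { f | ∃ F : (Fin n → ℝ) → ℝ,
      ContDiffOn ℝ r F (convexHull ℝ (Set.range e)) ∧
      (∀ x : (convexHull ℝ (Set.range e) : Set (Fin n → ℝ)), f x = F ↑x) ∧
      ∀ i : Fin (n + 1), ∃ p : MvPolynomial (Fin n) ℝ,
        p.totalDegree ≤ k ∧ ∀ x ∈ alfeldCell e v i, F x = eval x p }
  add_mem' := by
    rintro f g ⟨F, hF, hfF, hFp⟩ ⟨G, hG, hgG, hGp⟩
    refine ⟨F + G, hF.add hG, fun x => by simp [hfF x, hgG x], fun i => ?_⟩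
    obtain ⟨p, hp, hpe⟩ := hFp i
    obtain ⟨q, hq, hqe⟩ := hGp i
    exact ⟨p + q, le_trans (MvPolynomial.totalDegree_add p q) (max_le hp hq),
      fun x hx => by simp [hpe x hx, hqe x hx]⟩
  zero_mem' :=
    ⟨0, contDiffOn_const, fun x => rfl, fun i => ⟨0, by simp, fun x hx => by simp⟩⟩
  smul_mem' := by
    rintro c f ⟨F, hF, hfF, hFp⟩
    refine ⟨c • F, hF.const_smul c, fun x => by simp [hfF x], fun i => ?_⟩
    obtain ⟨p, hp, hpe⟩ := hFp i
    exact ⟨c • p, le_trans (MvPolynomial.totalDegree_smul_le c p) hp,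
      fun x hx => by simp [hpe x hx, MvPolynomial.smul_eq_C_mul]⟩

section OneVariable

variable {R : Type*} [CommRing R] [Algebra ℚ R]

theorem dvd_eval_one_sub_eval_zero {K g : Polynomial R} {c : R}
    (h : Polynomial.derivative K = Polynomial.C c * g) : c ∣ K.eval 1 - K.eval 0 := by
  have hcoeff : ∀ m, c ∣ K.coeff (m + 1) := fun m => by
    have hu : IsUnit ((m : R) + 1) := by
      have h1 : IsUnit ((m : ℚ) + 1) := isUnit_iff_ne_zero.2 (by positivity)
      simpa using h1.map (algebraMap ℚ R)
    have h2 := congrArg (fun q => Polynomial.coeff q m) h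
    simp only [Polynomial.coeff_derivative, Polynomial.coeff_C_mul] at h2
    exact hu.dvd_mul_right.1 (h2 ▸ Dvd.intro _ rfl)
  rw [Polynomial.eval_eq_sum_range, Finset.sum_range_succ', ← Polynomial.coeff_zero_eq_eval_zero]
  simp only [one_pow, mul_one, add_sub_cancel_right]
  exact Finset.dvd_sum fun m _ => hcoeff m

/-- If `H' = (T - α)^a (T - β)^b g` then `H(α) - H(β) = ∫_β^α H'` is divisible by
`(α - β)^(a + b + 1)`. -/
theorem pow_dvd_eval_sub_eval {H g : Polynomial R} {α β : R} {a b : ℕ}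
    (h : Polynomial.derivative H =
      (Polynomial.X - Polynomial.C α) ^ a * (Polynomial.X - Polynomial.C β) ^ b * g) :
    (α - β) ^ (a + b + 1) ∣ H.eval α - H.eval β := by
  have key := dvd_eval_one_sub_eval_zero (c := (α - β) ^ (a + b + 1))
    (K := H.comp (Polynomial.C β + Polynomial.C (α - β) * Polynomial.X))
    (g := (Polynomial.X - 1) ^ a * Polynomial.X ^ b *
      g.comp (Polynomial.C β + Polynomial.C (α - β) * Polynomial.X)) (by
    have h1 : (Polynomial.X - Polynomial.C α).comp
        (Polynomial.C β + Polynomial.C (α - β) * Polynomial.X) =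
        Polynomial.C (α - β) * (Polynomial.X - 1) := by
      simp; ring
    have h2 : (Polynomial.X - Polynomial.C β).comp
        (Polynomial.C β + Polynomial.C (α - β) * Polynomial.X) =
        Polynomial.C (α - β) * Polynomial.X := by
      simp
    rw [Polynomial.derivative_comp, h, Polynomial.mul_comp, Polynomial.mul_comp,
      Polynomial.pow_comp, Polynomial.pow_comp, h1, h2]
    simp only [Polynomial.derivative_add, Polynomial.derivative_C, Polynomial.derivative_C_mul,
      Polynomial.derivative_X, Polynomial.C_pow, mul_pow]
    ring)
  simpa using key

/-- The formal antiderivative with zero constant term. -/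
def antiderivative (w : Polynomial R) : Polynomial R :=
  ∑ m ∈ Finset.range (w.natDegree + 1), Polynomial.monomial (m + 1) (((m : ℚ) + 1)⁻¹ • w.coeff m)

theorem derivative_antiderivative (w : Polynomial R) :
    Polynomial.derivative (antiderivative w) = w := by
  conv_rhs => rw [w.as_sum_range]
  rw [antiderivative, Polynomial.derivative_sum]
  refine Finset.sum_congr rfl fun m _ => ?_
  rw [Polynomial.derivative_monomial, Nat.add_sub_cancel]
  congr 1
  have hm : ((m : ℚ) + 1) ≠ 0 := by positivity
  have h1 : ((m + 1 : ℕ) : R) = algebraMap ℚ R ((m : ℚ) + 1) := by simp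
  rw [h1, mul_comm, ← Algebra.smul_def, smul_smul, mul_inv_cancel₀ hm, one_smul]

theorem eval_zero_antiderivative (w : Polynomial R) : (antiderivative w).eval 0 = 0 := by
  simp [antiderivative, Polynomial.eval_finsetSum]

end OneVariable

section JointDegree

variable {σ : Type*}

/-- The total degree of `p`, counting the main variable with weight one, is at most `D`. -/
def JointDegreeLE (p : Polynomial (MvPolynomial σ ℝ)) (D : ℕ) : Prop :=
  ∀ m, p.coeff m ≠ 0 → (p.coeff m).totalDegree + m ≤ D

theorem JointDegreeLE.mul {p q : Polynomial (MvPolynomial σ ℝ)} {D E : ℕ}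
    (hp : JointDegreeLE p D) (hq : JointDegreeLE q E) : JointDegreeLE (p * q) (D + E) := by
  intro m hm
  have hex : ∃ x ∈ Finset.HasAntidiagonal.antidiagonal m, p.coeff x.1 * q.coeff x.2 ≠ 0 := by
    rw [Polynomial.coeff_mul] at hm
    exact Finset.exists_ne_zero_of_sum_ne_zero hm
  have key : ∀ x ∈ Finset.HasAntidiagonal.antidiagonal m, p.coeff x.1 * q.coeff x.2 ≠ 0 →
      (p.coeff x.1 * q.coeff x.2).totalDegree + m ≤ D + E := by
    intro x hx hne
    have h1 := hp x.1 (left_ne_zero_of_mul hne)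
    have h2 := hq x.2 (right_ne_zero_of_mul hne)
    have h3 := totalDegree_mul (p.coeff x.1) (q.coeff x.2)
    have h4 := Finset.HasAntidiagonal.mem_antidiagonal.1 hx
    omega
  have hmD : m ≤ D + E := by
    obtain ⟨x, hx, hne⟩ := hex
    have := key x hx hne
    omega
  have hle : ((p * q).coeff m).totalDegree ≤ D + E - m := by
    rw [Polynomial.coeff_mul]
    refine totalDegree_finsetSum_le fun x hx => ?_
    by_cases hne : p.coeff x.1 * q.coeff x.2 = 0
    · simp [hne]
    · have := key x hx hne
      omega
  omega

theorem jointDegreeLE_one : JointDegreeLE (1 : Polynomial (MvPolynomial σ ℝ)) 0 := by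
  intro m hm
  rw [Polynomial.coeff_one] at hm ⊢
  split_ifs at hm ⊢ with h
  · simp [h]
  · simp at hm

theorem JointDegreeLE.prod {ι : Type*} (s : Finset ι) {p : ι → Polynomial (MvPolynomial σ ℝ)}
    {D : ι → ℕ} (h : ∀ i ∈ s, JointDegreeLE (p i) (D i)) :
    JointDegreeLE (∏ i ∈ s, p i) (∑ i ∈ s, D i) := by
  classical
  induction s using Finset.induction_on with
  | empty => exact jointDegreeLE_one
  | insert a s ha ih =>
    rw [Finset.prod_insert ha, Finset.sum_insert ha]
    exact (h a (Finset.mem_insert_self a s)).mul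
      (ih fun i hi => h i (Finset.mem_insert_of_mem hi))

theorem jointDegreeLE_X_sub_C {ℓ : MvPolynomial σ ℝ} (h : ℓ.totalDegree ≤ 1) :
    JointDegreeLE (Polynomial.X - Polynomial.C ℓ) 1 := by
  intro m hm
  rcases m with _ | _ | m
  · simpa using h
  · simp [Polynomial.coeff_X]
  · simp [Polynomial.coeff_X] at hm

theorem JointDegreeLE.antiderivative {p : Polynomial (MvPolynomial σ ℝ)} {D : ℕ}
    (h : JointDegreeLE p D) : JointDegreeLE (antiderivative p) (D + 1) := by
  intro m hm
  rw [_root_.antiderivative, Polynomial.finsetSum_coeff] at hm ⊢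
  simp only [Polynomial.coeff_monomial] at hm ⊢
  obtain ⟨i, -, hi⟩ := Finset.exists_ne_zero_of_sum_ne_zero hm
  have him : i + 1 = m := by
    by_contra hne
    simp [hne] at hi
  subst him
  have hc : p.coeff i ≠ 0 := by
    intro h0
    simp [h0] at hi
  have hD := h i hc
  have : (∑ x ∈ Finset.range (p.natDegree + 1),
      if x + 1 = i + 1 then ((x : ℚ) + 1)⁻¹ • p.coeff x else 0).totalDegree ≤ D - i := by
    refine totalDegree_finsetSum_le fun x _ => ?_
    split_ifs with hx
    · obtain rfl : x = i := by omega
      exact (totalDegree_smul_le _ _).trans (by omega)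
    · simp
  omega

theorem JointDegreeLE.totalDegree_eval {p : Polynomial (MvPolynomial σ ℝ)} {D : ℕ}
    (h : JointDegreeLE p D) {ℓ : MvPolynomial σ ℝ} (hℓ : ℓ.totalDegree ≤ 1) :
    (p.eval ℓ).totalDegree ≤ D := by
  rw [Polynomial.eval_eq_sum_range]
  refine totalDegree_finsetSum_le fun m _ => ?_
  by_cases hm : p.coeff m = 0
  · simp [hm]
  · have h1 := h m hm
    have h2 := totalDegree_mul (p.coeff m) (ℓ ^ m)
    have h3 := totalDegree_pow ℓ m
    have h4 : m * ℓ.totalDegree ≤ m * 1 := Nat.mul_le_mul_left m hℓ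
    omega

end JointDegree

section BraidForms

variable {n : ℕ}

/-- The linear forms `0, X_0, …, X_{n-1}`, whose pairwise differences define the braid
arrangement. -/
def braidForm (n : ℕ) : Fin (n + 1) → MvPolynomial (Fin n) ℝ := Fin.cons 0 X

/-- The point of `ℝ^n ≅ ℝ^(n+1) / ℝ(1, …, 1)` represented by `c`. -/
def braidPoint (c : Fin (n + 1) → ℝ) : Fin n → ℝ := fun a => c a.succ - c 0

@[simp]
theorem braidForm_zero : braidForm n 0 = 0 := rfl

@[simp]
theorem braidForm_succ (a : Fin n) : braidForm n a.succ = X a := rfl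

@[simp]
theorem eval_braidPoint (c : Fin (n + 1) → ℝ) (i : Fin (n + 1)) :
    eval (braidPoint c) (braidForm n i) = c i - c 0 := by
  cases i using Fin.cases <;> simp [braidPoint]

theorem totalDegree_braidForm_le (i : Fin (n + 1)) : (braidForm n i).totalDegree ≤ 1 := by
  cases i using Fin.cases <;> simp

theorem totalDegree_braidForm_sub {i j : Fin (n + 1)} (h : i ≠ j) :
    (braidForm n i - braidForm n j).totalDegree = 1 := by
  apply le_antisymm
  · exact (totalDegree_sub _ _).trans
      (max_le (totalDegree_braidForm_le i) (totalDegree_braidForm_le j))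
  · by_contra hlt
    have h0 : (braidForm n i - braidForm n j).totalDegree = 0 := by omega
    rw [totalDegree_eq_zero_iff_eq_C] at h0
    have h1 := congrArg (eval (braidPoint (Pi.single i 1))) h0
    have h2 := congrArg (eval (braidPoint (0 : Fin (n + 1) → ℝ))) h0
    simp only [map_sub, eval_braidPoint, eval_C, Pi.single_eq_same, Pi.single_eq_of_ne h.symm,
      Pi.zero_apply] at h1 h2
    linarith

theorem braidForm_sub_ne_zero {i j : Fin (n + 1)} (h : i ≠ j) :
    braidForm n i - braidForm n j ≠ 0 := by
  intro h0
  simpa [h0] using totalDegree_braidForm_sub h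

theorem irreducible_braidForm_sub {i j : Fin (n + 1)} (h : i ≠ j) :
    Irreducible (braidForm n i - braidForm n j) := by
  refine irreducible_of_totalDegree_eq_one (totalDegree_braidForm_sub h) fun x hx => ?_
  obtain ⟨s, hs⟩ := ne_zero_iff.1 (braidForm_sub_ne_zero h)
  exact isUnit_iff_ne_zero.2 fun h0 => hs (by simpa [h0] using hx s)

theorem not_braidForm_sub_dvd {i j k l : Fin (n + 1)} (hkl : k ≠ l) (hki : k ≠ i) (hkj : k ≠ j) :
    ¬ (braidForm n i - braidForm n j ∣ braidForm n k - braidForm n l) := by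
  rintro ⟨q, hq⟩
  have h := congrArg (eval (braidPoint (Pi.single k 1))) hq
  simp [hkl.symm, hki.symm, hkj.symm] at h

theorem isRelPrime_braidForm_sub {p q : Fin (n + 1) × Fin (n + 1)} (hp : p.1 < p.2)
    (hq : q.1 < q.2) (hpq : p ≠ q) :
    IsRelPrime (braidForm n p.1 - braidForm n p.2) (braidForm n q.1 - braidForm n q.2) := by
  refine (irreducible_braidForm_sub hp.ne).isRelPrime_iff_not_dvd.2 ?_
  obtain ⟨i, j⟩ := p
  obtain ⟨k, l⟩ := q
  simp only at hp hq
  by_cases hk : k ≠ i ∧ k ≠ j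
  · exact not_braidForm_sub_dvd hq.ne hk.1 hk.2
  · rw [← dvd_neg, neg_sub]
    refine not_braidForm_sub_dvd hq.ne' ?_ ?_
    · rintro rfl
      exact hk ⟨hq.ne, (hq.trans hp).ne⟩
    · rintro rfl
      refine hk ⟨?_, hq.ne⟩
      rintro rfl
      exact hpq rfl

/-- The `K`-th power of the defining polynomial of the braid arrangement. -/
def braidDiscriminant (n K : ℕ) : MvPolynomial (Fin n) ℝ :=
  ∏ p : Fin (n + 1) × Fin (n + 1) with p.1 < p.2, (braidForm n p.1 - braidForm n p.2) ^ K

theorem braidDiscriminant_ne_zero (n K : ℕ) : braidDiscriminant n K ≠ 0 :=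
  Finset.prod_ne_zero_iff.2 fun _ hp =>
    pow_ne_zero K (braidForm_sub_ne_zero (Finset.mem_filter.1 hp).2.ne)

theorem totalDegree_prod_of_ne_zero {σ ι : Type*} (s : Finset ι) {f : ι → MvPolynomial σ ℝ}
    (h : ∀ i ∈ s, f i ≠ 0) : (∏ i ∈ s, f i).totalDegree = ∑ i ∈ s, (f i).totalDegree := by
  classical
  induction s using Finset.induction_on with
  | empty => simp
  | insert a s ha ih =>
    have hs : ∀ i ∈ s, f i ≠ 0 := fun i hi => h i (Finset.mem_insert_of_mem hi)
    rw [Finset.prod_insert ha, Finset.sum_insert ha,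
      totalDegree_mul_of_isDomain (h a (Finset.mem_insert_self a s))
        (Finset.prod_ne_zero_iff.2 hs), ih hs]

theorem card_filter_fst_lt_snd (N : ℕ) :
    2 * (Finset.univ.filter fun p : Fin N × Fin N => p.1 < p.2).card = N * (N - 1) := by
  have h1 : (Finset.univ.filter fun p : Fin N × Fin N => p.1 < p.2).card =
      ∑ i : Fin N, (i : ℕ) := by
    rw [Finset.card_filter, Fintype.sum_prod_type_right]
    refine Finset.sum_congr rfl fun i _ => ?_
    rw [← Finset.card_filter, ← Fin.card_Iio i]
    congr 1
    ext
    simp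
  rw [h1, Fin.sum_univ_eq_sum_range (fun i => i), mul_comm, Finset.sum_range_id_mul_two]

theorem totalDegree_braidDiscriminant (n s : ℕ) :
    (braidDiscriminant n (2 * s)).totalDegree = n * (s * (n + 1)) := by
  rw [braidDiscriminant, totalDegree_prod_of_ne_zero _ fun p hp =>
    pow_ne_zero _ (braidForm_sub_ne_zero (Finset.mem_filter.1 hp).2.ne)]
  have h : ∀ p ∈ Finset.univ.filter fun p : Fin (n + 1) × Fin (n + 1) => p.1 < p.2,
      ((braidForm n p.1 - braidForm n p.2) ^ (2 * s)).totalDegree = 2 * s := fun p hp => by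
    have hne := (Finset.mem_filter.1 hp).2.ne
    rw [Finset.pow_eq_prod_const,
      totalDegree_prod_of_ne_zero _ fun _ _ => braidForm_sub_ne_zero hne]
    simp [totalDegree_braidForm_sub hne]
  rw [Finset.sum_congr rfl h, Finset.sum_const, smul_eq_mul]
  have := card_filter_fst_lt_snd (n + 1)
  rw [Nat.add_sub_cancel] at this
  linear_combination s * this

/-- Tuples of polynomials on the cones of the Alfeld split that join with smoothness `K - 1`. -/
def BraidCompatible (K : ℕ) (f : Fin (n + 1) → MvPolynomial (Fin n) ℝ) : Prop :=
  ∀ i j, (braidForm n i - braidForm n j) ^ K ∣ f i - f j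

theorem braidDiscriminant_dvd_det {K : ℕ} {N : Matrix (Fin n) (Fin n) (MvPolynomial (Fin n) ℝ)}
    (hN : ∀ k, BraidCompatible K (Fin.cons 0 fun i => N i k)) :
    braidDiscriminant n K ∣ N.det := by
  refine Finset.prod_dvd_of_isRelPrime (fun p hp q hq hpq => ?_) fun p hp => ?_
  · simp only [Finset.coe_filter, Finset.mem_univ, true_and, Set.mem_ofPred_eq] at hp hq
    exact (isRelPrime_braidForm_sub hp hq hpq).pow
  · obtain ⟨i, j⟩ := p
    have hij : i < j := (Finset.mem_filter.1 hp).2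
    obtain ⟨b, rfl⟩ := Fin.exists_succ_eq.2 (Fin.ne_zero_of_lt hij)
    have hdet : ∀ r : Fin n → MvPolynomial (Fin n) ℝ, (N.updateRow b r).det = N.det →
        (∀ k, (braidForm n i - braidForm n b.succ) ^ K ∣ r k) →
        (braidForm n i - braidForm n b.succ) ^ K ∣ N.det := by
      intro r hr hdvd
      choose q hq using hdvd
      rw [← hr, show r = (braidForm n i - braidForm n b.succ) ^ K • q from funext hq,
        Matrix.det_updateRow_smul]
      exact dvd_mul_right _ _
    cases i using Fin.cases with
    | zero =>
      refine hdet (N b) (by rw [Matrix.updateRow_eq_self]) fun k => ?_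
      simpa using hN k 0 b.succ
    | succ a =>
      have hab : b ≠ a := by
        rintro rfl
        exact lt_irrefl _ hij
      refine hdet (N b + (-1 : MvPolynomial (Fin n) ℝ) • N a)
        (Matrix.det_updateRow_add_smul_self N hab _) fun k => ?_
      have h := hN k a.succ b.succ
      rw [← dvd_neg] at h
      simpa [sub_eq_add_neg, add_comm] using h

theorem totalDegree_det_le {N : Matrix (Fin n) (Fin n) (MvPolynomial (Fin n) ℝ)} {d : Fin n → ℕ}
    (hN : ∀ i k, (N i k).totalDegree ≤ d k) : N.det.totalDegree ≤ ∑ k, d k := by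
  rw [Matrix.det_apply]
  refine totalDegree_finsetSum_le fun π _ => ?_
  rw [Units.smul_def]
  refine (totalDegree_smul_le _ _).trans ((totalDegree_finsetProd _ _).trans ?_)
  exact Finset.sum_le_sum fun k _ => hN _ k

end BraidForms

section Generators

variable {n : ℕ}

/-- The integrand `∏_j (T - ℓ_j)^(m+1) / (T - ℓ_(k+1))`. -/
def braidIntegrand (n m : ℕ) (k : Fin n) : Polynomial (MvPolynomial (Fin n) ℝ) :=
  (∏ j, (Polynomial.X - Polynomial.C (braidForm n j))) ^ m *
    ∏ j ∈ Finset.univ.erase k.succ, (Polynomial.X - Polynomial.C (braidForm n j))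

/-- The generators of the module of splines of smoothness `2m + 1`: on the `i`-th cone, the integral
of `braidIntegrand` from `0` to `ℓ_i`. -/
def braidSpline (n m : ℕ) (k : Fin n) (i : Fin (n + 1)) : MvPolynomial (Fin n) ℝ :=
  (antiderivative (braidIntegrand n m k)).eval (braidForm n i)

@[simp]
theorem braidSpline_zero (m : ℕ) (k : Fin n) : braidSpline n m k 0 = 0 :=
  eval_zero_antiderivative _

theorem jointDegreeLE_braidIntegrand (m : ℕ) (k : Fin n) :
    JointDegreeLE (braidIntegrand n m k) (m * (n + 1) + n) := by
  have h1 : ∀ s : Finset (Fin (n + 1)), JointDegreeLE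
      (∏ j ∈ s, (Polynomial.X - Polynomial.C (braidForm n j))) s.card := fun s => by
    simpa using JointDegreeLE.prod s (D := fun _ => 1)
      fun j _ => jointDegreeLE_X_sub_C (totalDegree_braidForm_le j)
  have h2 := JointDegreeLE.prod (Finset.range m) fun _ _ => h1 Finset.univ
  refine JointDegreeLE.mul ?_ ?_
  · simpa using h2
  · simpa using h1 (Finset.univ.erase k.succ)

theorem totalDegree_braidSpline_le (m : ℕ) (k : Fin n) (i : Fin (n + 1)) :
    (braidSpline n m k i).totalDegree ≤ (m + 1) * (n + 1) :=
  ((jointDegreeLE_braidIntegrand m k).antiderivative.totalDegree_eval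
    (totalDegree_braidForm_le i)).trans (by ring_nf; rfl)

theorem braidCompatible_braidSpline (m : ℕ) (k : Fin n) :
    BraidCompatible (2 * m + 2) (braidSpline n m k) := by
  intro i j
  wlog hik : i ≠ k.succ generalizing i j
  · by_cases hjk : j ≠ k.succ
    · have h := this j i hjk
      rwa [← neg_sub (braidForm n i), ← neg_sub (braidSpline n m k i), dvd_neg,
        Even.neg_pow ⟨m + 1, by ring⟩] at h
    · push Not at hik hjk
      simp [hik, hjk]
  rcases eq_or_ne i j with rfl | hij
  · simp
  have hpair : (Polynomial.X - Polynomial.C (braidForm n i)) *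
      (Polynomial.X - Polynomial.C (braidForm n j)) ∣
      ∏ j, (Polynomial.X - Polynomial.C (braidForm n j)) := by
    rw [← Finset.mul_prod_erase _ _ (Finset.mem_univ i)]
    exact mul_dvd_mul_left _ (Finset.dvd_prod_of_mem _ (by simp [hij.symm]))
  have hi : (Polynomial.X - Polynomial.C (braidForm n i)) ∣
      ∏ j ∈ Finset.univ.erase k.succ, (Polynomial.X - Polynomial.C (braidForm n j)) :=
    Finset.dvd_prod_of_mem _ (by simp [hik])
  obtain ⟨g, hg⟩ := mul_dvd_mul (pow_dvd_pow_of_dvd hpair m) hi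
  have h := pow_dvd_eval_sub_eval (H := antiderivative (braidIntegrand n m k)) (g := g)
    (α := braidForm n i) (β := braidForm n j) (a := m + 1) (b := m) (by
      rw [derivative_antiderivative, braidIntegrand, hg, mul_pow]
      ring)
  rwa [show 2 * m + 2 = m + 1 + m + 1 by ring]

/-- The coefficient matrix of the generators; its rows omit the zeroth cone. -/
def braidMatrix (n m : ℕ) : Matrix (Fin n) (Fin n) (MvPolynomial (Fin n) ℝ) :=
  Matrix.of fun i k => braidSpline n m k i.succ

theorem braidMatrix_mulVec (m : ℕ) (g : Fin n → MvPolynomial (Fin n) ℝ) (i : Fin n) :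
    (braidMatrix n m).mulVec g i = ∑ k, g k * braidSpline n m k i.succ := by
  simp only [Matrix.mulVec, dotProduct]
  exact Finset.sum_congr rfl fun k _ => mul_comm _ _

theorem map_braidIntegrand (m : ℕ) (k : Fin n) (y : Fin n → ℝ) :
    (braidIntegrand n m k).map (eval y) =
      (∏ j, (Polynomial.X - Polynomial.C (eval y (braidForm n j)))) ^ m *
        ∏ j ∈ Finset.univ.erase k.succ,
          (Polynomial.X - Polynomial.C (eval y (braidForm n j))) := by
  simp [braidIntegrand, Polynomial.map_prod]

theorem det_braidMatrix_ne_zero (n m : ℕ) : (braidMatrix n m).det ≠ 0 := by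
  intro hdet
  set y : Fin n → ℝ := braidPoint fun i => (i : ℝ) with hy
  have hℓ : ∀ i : Fin (n + 1), eval y (braidForm n i) = (i : ℝ) := fun i => by
    simp [hy]
  have h0 : ((eval y).mapMatrix (braidMatrix n m)).det = 0 := by
    rw [← RingHom.map_det, hdet, map_zero]
  obtain ⟨c, hc, hMc⟩ := Matrix.exists_mulVec_eq_zero_iff.2 h0
  set G : Polynomial ℝ :=
    ∑ k, Polynomial.C (c k) * (antiderivative (braidIntegrand n m k)).map (eval y) with hG
  have hGeval : ∀ i : Fin (n + 1), G.eval (i : ℝ) = 0 := fun i => by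
    rw [hG, Polynomial.eval_finsetSum, ← hℓ i]
    cases i using Fin.cases with
    | zero =>
      refine Finset.sum_eq_zero fun k _ => ?_
      rw [Polynomial.eval_mul, Polynomial.eval_map_apply, braidForm_zero,
        eval_zero_antiderivative]
      simp
    | succ a =>
      have h := congrFun hMc a
      simp only [Matrix.mulVec, dotProduct, Pi.zero_apply] at h
      rw [← h]
      refine Finset.sum_congr rfl fun k _ => ?_
      rw [Polynomial.eval_mul, Polynomial.eval_map_apply, Polynomial.eval_C, mul_comm]
      rfl
  set P : Polynomial ℝ := ∑ k : Fin n, Polynomial.C (c k) *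
    ∏ j ∈ Finset.univ.erase k, (Polynomial.X - Polynomial.C ((j : ℝ) + 1)) with hP
  have hG' : Polynomial.derivative G =
      (∏ j : Fin (n + 1), (Polynomial.X - Polynomial.C (j : ℝ))) ^ m * (Polynomial.X * P) := by
    rw [hG, hP, Polynomial.derivative_sum, Finset.mul_sum, Finset.mul_sum]
    refine Finset.sum_congr rfl fun k _ => ?_
    have hk : (Finset.univ.erase k.succ : Finset (Fin (n + 1))) =
        insert 0 ((Finset.univ.erase k).map (Fin.succEmb n)) := by
      ext i
      cases i using Fin.cases <;> simp [(Fin.succ_ne_zero k).symm]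
    rw [Polynomial.derivative_C_mul, Polynomial.derivative_map, derivative_antiderivative,
      map_braidIntegrand, hk, Finset.prod_insert (by simp [Fin.succ_ne_zero]), Finset.prod_map]
    simp only [hℓ, Fin.val_zero, Nat.cast_zero, Polynomial.C_0, sub_zero, Fin.coe_succEmb,
      Fin.val_succ, Nat.cast_add, Nat.cast_one]
    ring
  have hroot : ∀ a : Fin n, ∃ t : ℝ, (a : ℝ) < t ∧ t < (a : ℝ) + 1 ∧ P.eval t = 0 := fun a => by
    have h1 := hGeval a.castSucc
    have h2 := hGeval a.succ
    simp only [Fin.val_castSucc, Fin.val_succ, Nat.cast_add, Nat.cast_one] at h1 h2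
    obtain ⟨t, ht, hd⟩ := exists_hasDerivAt_eq_zero (f := fun t => G.eval t)
      (f' := fun t => (Polynomial.derivative G).eval t) (lt_add_one (a : ℝ))
      G.continuous.continuousOn (h1.trans h2.symm) fun t _ => G.hasDerivAt t
    refine ⟨t, ht.1, ht.2, ?_⟩
    simp only [hG', Polynomial.eval_mul, Polynomial.eval_pow, Polynomial.eval_prod,
      Polynomial.eval_sub, Polynomial.eval_X, Polynomial.eval_C] at hd
    have hne : ∏ j : Fin (n + 1), (t - (j : ℝ)) ≠ 0 := by
      refine Finset.prod_ne_zero_iff.2 fun j _ h => ?_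
      have htj : t = (j : ℝ) := by linarith
      rw [htj] at ht
      have h3 : (a : ℕ) < (j : ℕ) := by exact_mod_cast ht.1
      have h4 : (j : ℕ) < (a : ℕ) + 1 := by exact_mod_cast ht.2
      omega
    have ht0 : t ≠ 0 := ((Nat.cast_nonneg (a : ℕ)).trans_lt ht.1).ne'
    simpa [hne, ht0] using hd
  choose t ht1 ht2 ht3 using hroot
  have htinj : Function.Injective t := by
    intro a b hab
    have h1 := ht1 a
    have h2 := ht2 a
    rw [hab] at h1 h2
    have h3 : (a : ℝ) < (b : ℝ) + 1 := h1.trans (ht2 b)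
    have h4 : (b : ℝ) < (a : ℝ) + 1 := (ht1 b).trans h2
    have h5 : (a : ℕ) < (b : ℕ) + 1 := by exact_mod_cast h3
    have h6 : (b : ℕ) < (a : ℕ) + 1 := by exact_mod_cast h4
    ext
    omega
  obtain ⟨a, ha⟩ := Function.ne_iff.1 hc
  have hdeg : P.natDegree < Fintype.card (Fin n) := by
    have hn : 0 < n := a.pos
    rw [Fintype.card_fin]
    refine (Polynomial.natDegree_sum_le_of_forall_le (n := n - 1) _ _ fun k _ => ?_).trans_lt
      (by omega)
    refine (Polynomial.natDegree_C_mul_le _ _).trans ?_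
    rw [Polynomial.natDegree_prod_of_monic _ _ fun j _ => Polynomial.monic_X_sub_C _,
      Finset.sum_congr rfl fun j _ => Polynomial.natDegree_X_sub_C _]
    simp
  have hP0 := Polynomial.eq_zero_of_natDegree_lt_card_of_eval_eq_zero P htinj ht3 hdeg
  have hPa : P.eval ((a : ℝ) + 1) = c a * ∏ j ∈ Finset.univ.erase a, ((a : ℝ) - j) := by
    rw [hP, Polynomial.eval_finsetSum, Finset.sum_eq_single a]
    · simp [Polynomial.eval_prod]
    · intro k _ hk
      rw [Polynomial.eval_mul, Polynomial.eval_prod,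
        Finset.prod_eq_zero (i := a) (by simp [hk.symm]) (by simp), mul_zero]
    · simp
  rw [hP0, Polynomial.eval_zero] at hPa
  refine mul_ne_zero ha (Finset.prod_ne_zero_iff.2 fun j hj h => ?_) hPa.symm
  have h1 : (a : ℕ) = j := by exact_mod_cast sub_eq_zero.1 h
  exact (Finset.mem_erase.1 hj).1 (Fin.ext h1.symm)

theorem totalDegree_det_braidMatrix_le (n m : ℕ) :
    (braidMatrix n m).det.totalDegree ≤ n * ((m + 1) * (n + 1)) := by
  simpa using totalDegree_det_le (N := braidMatrix n m) (d := fun _ => (m + 1) * (n + 1))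
    fun i k => totalDegree_braidSpline_le m k i.succ

theorem exists_det_braidMatrix_eq (n m : ℕ) :
    ∃ c : ℝ, c ≠ 0 ∧ (braidMatrix n m).det = C c * braidDiscriminant n (2 * (m + 1)) := by
  obtain ⟨q, hq⟩ : braidDiscriminant n (2 * (m + 1)) ∣ (braidMatrix n m).det := by
    refine braidDiscriminant_dvd_det fun k => ?_
    convert! braidCompatible_braidSpline m k using 1
    funext i
    cases i using Fin.cases <;> simp [braidMatrix]
  have hne := det_braidMatrix_ne_zero n m
  have hq0 : q ≠ 0 := by
    rintro rfl
    exact hne (by rw [hq, mul_zero])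
  have hdeg := totalDegree_det_braidMatrix_le n m
  rw [hq, totalDegree_mul_of_isDomain (braidDiscriminant_ne_zero _ _) hq0,
    totalDegree_braidDiscriminant] at hdeg
  have hqC := totalDegree_eq_zero_iff_eq_C.1 (show q.totalDegree = 0 by omega)
  refine ⟨coeff 0 q, fun h => hq0 (by rw [hqC, h, C_0]), ?_⟩
  rw [hq, ← hqC, mul_comm]

theorem totalDegree_det_braidMatrix (n m : ℕ) :
    (braidMatrix n m).det.totalDegree = n * ((m + 1) * (n + 1)) := by
  obtain ⟨c, hc, h⟩ := exists_det_braidMatrix_eq n m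
  rw [h, totalDegree_mul_of_isDomain (by simpa using hc) (braidDiscriminant_ne_zero _ _),
    totalDegree_braidDiscriminant, totalDegree_C, zero_add]

theorem braidSpline_linearIndependent {m : ℕ} {g : Fin n → MvPolynomial (Fin n) ℝ}
    (h : ∀ i, ∑ k, g k * braidSpline n m k i = 0) : g = 0 := by
  refine Matrix.eq_zero_of_mulVec_eq_zero (det_braidMatrix_ne_zero n m) ?_
  funext i
  rw [Pi.zero_apply, ← h i.succ]
  exact braidMatrix_mulVec m g i

theorem BraidCompatible.exists_eq_sum {m K : ℕ} {f : Fin (n + 1) → MvPolynomial (Fin n) ℝ}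
    (hf : BraidCompatible (2 * m + 2) f) (hdeg : ∀ i, (f i).totalDegree ≤ K) :
    ∃ g : Fin n → MvPolynomial (Fin n) ℝ,
      (∀ k, g k ≠ 0 → (g k).totalDegree + (m + 1) * (n + 1) ≤ K) ∧
      ∀ i, f i = f 0 + ∑ k, g k * braidSpline n m k i := by
  obtain ⟨c, hc, hdet⟩ := exists_det_braidMatrix_eq n m
  set b : Fin n → MvPolynomial (Fin n) ℝ := fun i => f i.succ - f 0 with hb
  have hcol : ∀ k, BraidCompatible (2 * (m + 1))
      (Fin.cons 0 fun i => (braidMatrix n m).updateCol k b i k) := fun k i j => by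
    have hcons : (Fin.cons 0 fun i => (braidMatrix n m).updateCol k b i k) =
        fun i => f i - f 0 := by
      funext i
      cases i using Fin.cases <;> simp [hb]
    rw [hcons]
    simpa [mul_add] using hf i j
  have hcol' : ∀ k l, BraidCompatible (2 * (m + 1))
      (Fin.cons 0 fun i => (braidMatrix n m).updateCol k b i l) := fun k l => by
    rcases eq_or_ne l k with rfl | hlk
    · exact hcol l
    · convert! braidCompatible_braidSpline m l using 1
      funext i
      cases i using Fin.cases <;> simp [braidMatrix, hlk]
  have hdvd : ∀ k, ∃ q, ((braidMatrix n m).updateCol k b).det = (braidMatrix n m).det * q :=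
    fun k => by
      obtain ⟨q, hq⟩ := braidDiscriminant_dvd_det (hcol' k)
      refine ⟨C c⁻¹ * q, ?_⟩
      rw [hq, hdet]
      have hcc : (C c * C c⁻¹ : MvPolynomial (Fin n) ℝ) = 1 := by
        rw [← C_mul, mul_inv_cancel₀ hc, C_1]
      linear_combination (-braidDiscriminant n (2 * (m + 1)) * q) * hcc
  choose g hg using hdvd
  have hne := det_braidMatrix_ne_zero n m
  refine ⟨g, fun k hk => ?_, fun i => ?_⟩
  · have h1 := congrArg totalDegree (hg k)
    rw [totalDegree_mul_of_isDomain hne hk, totalDegree_det_braidMatrix] at h1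
    have h2 := totalDegree_det_le (N := (braidMatrix n m).updateCol k b)
      (d := Function.update (fun _ => (m + 1) * (n + 1)) k K) fun i l => by
        rcases eq_or_ne l k with rfl | hlk
        · simpa [hb] using (totalDegree_sub _ _).trans (max_le (hdeg i.succ) (hdeg 0))
        · simpa [hlk, braidMatrix] using totalDegree_braidSpline_le m l i.succ
    rw [Finset.sum_update_of_mem (Finset.mem_univ k), Finset.sum_const, smul_eq_mul,
      Finset.card_sdiff_of_subset (Finset.subset_univ _), Finset.card_univ, Fintype.card_fin,
      Finset.card_singleton, h1] at h2
    obtain ⟨n, rfl⟩ : ∃ n', n = n' + 1 := ⟨n - 1, by have := k.pos; omega⟩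
    rw [Nat.add_sub_cancel] at h2
    linarith
  · cases i using Fin.cases with
    | zero => simp
    | succ a =>
      have h := congrFun (Matrix.mulVec_cramer (braidMatrix n m) b) a
      have hcr : Matrix.cramer (braidMatrix n m) b = (braidMatrix n m).det • g := by
        funext k
        rw [Matrix.cramer_apply, hg, Pi.smul_apply, smul_eq_mul]
      rw [hcr, Matrix.mulVec_smul, Pi.smul_apply, Pi.smul_apply, smul_eq_mul, smul_eq_mul] at h
      have h' := mul_left_cancel₀ hne h
      rw [← sub_eq_iff_eq_add', show f a.succ - f 0 = b a from rfl, ← h']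
      exact braidMatrix_mulVec m g a

end Generators

section Dimension

theorem sum_multichoose (n m : ℕ) :
    ∑ d ∈ Finset.range (m + 1), n.multichoose d = (n + 1).multichoose m := by
  induction m with
  | zero => simp
  | succ m ih => rw [Finset.sum_range_succ, ih, Nat.multichoose_succ_succ, add_comm]

theorem finrank_restrictTotalDegree (n m : ℕ) :
    Module.finrank ℝ (restrictTotalDegree (Fin n) ℝ m) = (m + n).choose n := by
  have hset : {f : Fin n →₀ ℕ | (f.sum fun _ e => e) ≤ m} =
      ((Finset.range (m + 1)).biUnion fun d => (Finset.univ : Finset (Fin n)).finsuppAntidiag d :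
        Finset (Fin n →₀ ℕ)) := by
    ext f
    simp [Finset.mem_finsuppAntidiag, Finsupp.sum_fintype]
  rw [restrictTotalDegree, Module.finrank_eq_nat_card_basis (basisRestrictSupport ℝ _), hset,
    Nat.card_coe_set_eq, Set.ncard_coe_finset, Finset.card_biUnion]
  · simp only [Finset.card_finsuppAntidiag_nat_eq_multichoose, Finset.card_univ, Fintype.card_fin]
    rw [sum_multichoose, Nat.multichoose_eq, Nat.add_right_comm, Nat.add_sub_cancel, add_comm n m,
      Nat.choose_symm_add]
  · intro d _ d' _ hdd
    refine Finset.disjoint_left.2 fun f hf hf' => hdd ?_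
    rw [Finset.mem_finsuppAntidiag] at hf hf'
    exact hf.1.symm.trans hf'.1

variable {n : ℕ}

/-- Polynomials of total degree at most `K - N`, where this difference may be negative. -/
def restrictTotalDegreeSub (n K N : ℕ) : Submodule ℝ (MvPolynomial (Fin n) ℝ) :=
  if N ≤ K then restrictTotalDegree (Fin n) ℝ (K - N) else ⊥

theorem mem_restrictTotalDegreeSub {K N : ℕ} {p : MvPolynomial (Fin n) ℝ} :
    p ∈ restrictTotalDegreeSub n K N ↔ (p ≠ 0 → p.totalDegree + N ≤ K) := by
  unfold restrictTotalDegreeSub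
  split_ifs with h
  · rw [mem_restrictTotalDegree]
    constructor
    · intro hp _
      omega
    · intro hp
      by_cases h0 : p = 0
      · simp [h0]
      · have := hp h0
        omega
  · rw [Submodule.mem_bot]
    constructor
    · intro h0 hne
      exact absurd h0 hne
    · intro hp
      by_contra h0
      have := hp h0
      omega

instance (K N : ℕ) : Module.Finite ℝ (restrictTotalDegreeSub n K N) := by
  by_cases h : N ≤ K
  · rw [restrictTotalDegreeSub, if_pos h]
    infer_instance
  · rw [restrictTotalDegreeSub, if_neg h]
    infer_instance

theorem finrank_restrictTotalDegreeSub (hn : 1 ≤ n) (K N : ℕ) :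
    Module.finrank ℝ (restrictTotalDegreeSub n K N) = (K + n - N).choose n := by
  by_cases h : N ≤ K
  · rw [restrictTotalDegreeSub, if_pos h, finrank_restrictTotalDegree, Nat.sub_add_comm h]
  · rw [restrictTotalDegreeSub, if_neg h, finrank_bot, Nat.choose_eq_zero_of_lt (by omega)]

/-- Compatible tuples of polynomials of total degree at most `K`. -/
def braidSplines (n m K : ℕ) : Submodule ℝ (Fin (n + 1) → MvPolynomial (Fin n) ℝ) where
  carrier := {f | (∀ i, (f i).totalDegree ≤ K) ∧ BraidCompatible (2 * m + 2) f}
  add_mem' := fun {f g} hf hg => by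
    refine ⟨fun i => (totalDegree_add _ _).trans (max_le (hf.1 i) (hg.1 i)), fun i j => ?_⟩
    simpa only [Pi.add_apply, add_sub_add_comm] using dvd_add (hf.2 i j) (hg.2 i j)
  zero_mem' := ⟨fun i => by simp, fun i j => by simp⟩
  smul_mem' := fun c f hf => by
    refine ⟨fun i => (totalDegree_smul_le _ _).trans (hf.1 i), fun i j => ?_⟩
    rw [Pi.smul_apply, Pi.smul_apply, ← smul_sub, smul_eq_C_mul]
    exact (hf.2 i j).mul_left (C c)

/-- The parametrisation of the compatible tuples by the coefficients of the generators. -/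
def braidParam (n m K : ℕ) :
    (restrictTotalDegree (Fin n) ℝ K ×
      (Fin n → restrictTotalDegreeSub n K ((m + 1) * (n + 1)))) →ₗ[ℝ]
      (Fin (n + 1) → MvPolynomial (Fin n) ℝ) where
  toFun g i := (g.1 : MvPolynomial (Fin n) ℝ) +
    ∑ k, (g.2 k : MvPolynomial (Fin n) ℝ) * braidSpline n m k i
  map_add' f g := by
    funext i
    simp only [Prod.fst_add, Prod.snd_add, Pi.add_apply, Submodule.coe_add, add_mul,
      Finset.sum_add_distrib]
    ring
  map_smul' c f := by
    funext i
    simp only [Prod.smul_fst, Prod.smul_snd, Pi.smul_apply, Submodule.coe_smul, smul_mul_assoc,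
      ← Finset.smul_sum, smul_add, RingHom.id_apply]

theorem braidParam_injective (n m K : ℕ) : Function.Injective (braidParam n m K) := by
  refine (injective_iff_map_eq_zero _).2 ?_
  rintro ⟨⟨g₀, hg₀⟩, g⟩ h
  have h0 : g₀ = 0 := by simpa [braidParam] using congrFun h 0
  have h1 := braidSpline_linearIndependent (m := m) (g := fun k => (g k : MvPolynomial (Fin n) ℝ))
    fun i => by simpa [braidParam, h0] using congrFun h i
  refine Prod.ext (Subtype.ext h0) (funext fun k => Subtype.ext (congrFun h1 k))

theorem range_braidParam (n m K : ℕ) : LinearMap.range (braidParam n m K) = braidSplines n m K := by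
  apply le_antisymm
  · rintro _ ⟨⟨⟨g₀, hg₀⟩, g⟩, rfl⟩
    refine ⟨fun i => ?_, fun i j => ?_⟩
    · refine (totalDegree_add _ _).trans (max_le ((mem_restrictTotalDegree _ _ _).1 hg₀) ?_)
      refine totalDegree_finsetSum_le fun k _ => ?_
      by_cases hk : (g k : MvPolynomial (Fin n) ℝ) = 0
      · simp [hk]
      · have h1 := mem_restrictTotalDegreeSub.1 (g k).2 hk
        have h2 := totalDegree_mul (g k : MvPolynomial (Fin n) ℝ) (braidSpline n m k i)
        have h3 := totalDegree_braidSpline_le m k i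
        exact h2.trans (by omega)
    · simp only [braidParam, LinearMap.coe_mk, AddHom.coe_mk, add_sub_add_left_eq_sub,
        ← Finset.sum_sub_distrib, ← mul_sub]
      exact Finset.dvd_sum fun k _ => (braidCompatible_braidSpline m k i j).mul_left _
  · rintro f ⟨hdeg, hf⟩
    obtain ⟨g, hg, hfg⟩ := hf.exists_eq_sum hdeg
    exact ⟨⟨⟨f 0, (mem_restrictTotalDegree _ _ _).2 (hdeg 0)⟩,
      fun k => ⟨g k, mem_restrictTotalDegreeSub.2 (hg k)⟩⟩, funext fun i => (hfg i).symm⟩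

theorem finrank_braidSplines (hn : 1 ≤ n) (m K : ℕ) :
    Module.finrank ℝ (braidSplines n m K) =
      (K + n).choose n + n * (K + n - (m + 1) * (n + 1)).choose n := by
  rw [← range_braidParam, LinearMap.finrank_range_of_inj (braidParam_injective n m K),
    Module.finrank_prod, Module.finrank_pi_fintype, finrank_restrictTotalDegree]
  simp [finrank_restrictTotalDegreeSub hn]

end Dimension

section PolynomialFunctions

variable {n : ℕ}

theorem MvPolynomial.eq_zero_of_forall_mem_isOpen {U : Set (Fin n → ℝ)} (hU : IsOpen U)
    (hne : U.Nonempty) {p : MvPolynomial (Fin n) ℝ} (hp : ∀ y ∈ U, eval y p = 0) : p = 0 := by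
  obtain ⟨x, hx⟩ := hne
  obtain ⟨ε, hε, hball⟩ := Metric.isOpen_iff.1 hU x hx
  refine funext_set (fun i => Metric.ball (x i) ε) (fun i => ?_) fun y hy => ?_
  · rw [Real.ball_eq_Ioo]
    exact Set.Ioo_infinite (by linarith)
  · rw [map_zero]
    refine hp y (hball ?_)
    rwa [ball_pi x hε]

theorem dvd_sub_bind₁ {σ R : Type*} [CommRing R] {l : MvPolynomial σ R}
    {s : σ → MvPolynomial σ R} (hs : ∀ a, l ∣ X a - s a) (P : MvPolynomial σ R) :
    l ∣ P - bind₁ s P := by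
  induction P using MvPolynomial.induction_on with
  | C c => simp
  | add p q hp hq => simpa only [map_add, add_sub_add_comm] using dvd_add hp hq
  | mul_X p a hp =>
    have h : p * X a - bind₁ s (p * X a) = (p - bind₁ s p) * X a + bind₁ s p * (X a - s a) := by
      simp only [map_mul, bind₁_X_right]
      ring
    rw [h]
    exact dvd_add (hp.mul_right _) ((hs a).mul_left _)

/-- The restriction of a polynomial to the line `t ↦ z + t w`. -/
def lineRestrict (z w : Fin n → ℝ) : MvPolynomial (Fin n) ℝ →ₐ[ℝ] Polynomial ℝ :=
  aeval fun a => Polynomial.C (z a) + Polynomial.C (w a) * Polynomial.X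

theorem eval_lineRestrict (z w : Fin n → ℝ) (P : MvPolynomial (Fin n) ℝ) (t : ℝ) :
    (lineRestrict z w P).eval t = eval (z + t • w) P := by
  induction P using MvPolynomial.induction_on with
  | C c => simp [lineRestrict]
  | add p q hp hq => simp [hp, hq]
  | mul_X p a hp =>
    rw [map_mul, Polynomial.eval_mul, hp, map_mul]
    congr 1
    simp [lineRestrict]
    ring

theorem lineRestrict_braidForm (z : Fin n → ℝ) (c : Fin (n + 1) → ℝ) (i : Fin (n + 1)) :
    lineRestrict z (braidPoint c) (braidForm n i) =
      Polynomial.C (eval z (braidForm n i)) + Polynomial.C (c i - c 0) * Polynomial.X := by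
  cases i using Fin.cases <;> simp [lineRestrict, braidPoint]

theorem eval_add_smul_braidForm (z : Fin n → ℝ) (c : Fin (n + 1) → ℝ) (t : ℝ) (i : Fin (n + 1)) :
    eval (z + t • braidPoint c) (braidForm n i) = eval z (braidForm n i) + t * (c i - c 0) := by
  rw [← eval_lineRestrict, lineRestrict_braidForm]
  simp [mul_comm]

/-- The projection to the hyperplane `ℓ_i = ℓ_j` along the `i`-th coordinate direction. -/
def braidProj (i j : Fin (n + 1)) (y : Fin n → ℝ) : Fin n → ℝ :=
  y + (-eval y (braidForm n i - braidForm n j)) • braidPoint (Pi.single i 1)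

theorem eval_braidProj {i j : Fin (n + 1)} (hij : i ≠ j) (y : Fin n → ℝ) :
    eval (braidProj i j y) (braidForm n i) = eval (braidProj i j y) (braidForm n j) := by
  simp only [braidProj, eval_add_smul_braidForm, Pi.single_eq_same, Pi.single_eq_of_ne hij.symm,
    map_sub]
  ring

theorem continuous_braidProj (i j : Fin (n + 1)) : Continuous (braidProj i j) :=
  continuous_id.add ((MvPolynomial.continuous_eval _).neg.smul continuous_const)

/-- Divisibility by `(ℓ_i - ℓ_j)^N` can be tested on lines transversal to `ℓ_i = ℓ_j`. -/
theorem braidForm_sub_pow_dvd {i j : Fin (n + 1)} (hij : i ≠ j) {V : Set (Fin n → ℝ)}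
    (hV : IsOpen V) (hne : V.Nonempty) (N : ℕ) (P : MvPolynomial (Fin n) ℝ)
    (h : ∀ y ∈ V, Polynomial.X ^ N ∣
      lineRestrict (braidProj i j y) (braidPoint (Pi.single i 1)) P) :
    (braidForm n i - braidForm n j) ^ N ∣ P := by
  induction N generalizing P with
  | zero => simp
  | succ N ih =>
    set l := braidForm n i - braidForm n j with hl
    set s : Fin n → MvPolynomial (Fin n) ℝ :=
      fun a => X a - l * C (braidPoint (Pi.single i 1) a) with hs
    have hbind : bind₁ s P = 0 := by
      refine MvPolynomial.eq_zero_of_forall_mem_isOpen hV hne fun y hy => ?_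
      have h0 : (lineRestrict (braidProj i j y) (braidPoint (Pi.single i 1)) P).eval 0 = 0 :=
        Polynomial.dvd_iff_isRoot.1 (by
          simpa using (dvd_pow_self Polynomial.X N.succ_ne_zero).trans (h y hy))
      rw [eval_lineRestrict, zero_smul, add_zero] at h0
      rw [← h0, ← coe_aeval_eq_eval, ← coe_aeval_eq_eval, RingHom.coe_coe, RingHom.coe_coe,
        aeval_bind₁]
      congr 2
      funext a
      simp [hs, braidProj, ← hl]
      ring
    obtain ⟨Q, rfl⟩ : l ∣ P := by
      have hdvd := dvd_sub_bind₁ (l := l) (s := s) (fun a => by simp [hs]) P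
      rwa [hbind, sub_zero] at hdvd
    rw [pow_succ']
    refine mul_dvd_mul_left l (ih Q fun y hy => ?_)
    have h1 := h y hy
    have hlX : lineRestrict (braidProj i j y) (braidPoint (Pi.single i 1)) l = Polynomial.X := by
      rw [hl, map_sub, lineRestrict_braidForm, lineRestrict_braidForm, eval_braidProj hij,
        Pi.single_eq_same, Pi.single_eq_of_ne hij.symm]
      simp only [map_sub, map_one, map_zero]
      ring
    rw [map_mul, hlX, pow_succ'] at h1
    exact (mul_dvd_mul_iff_left Polynomial.X_ne_zero).1 h1

theorem X_pow_succ_dvd_of_derivative {q : Polynomial ℝ} {N : ℕ} (h0 : q.eval 0 = 0)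
    (h : Polynomial.X ^ N ∣ Polynomial.derivative q) : Polynomial.X ^ (N + 1) ∣ q := by
  rw [Polynomial.X_pow_dvd_iff] at h ⊢
  rintro (_ | d) hd
  · rwa [Polynomial.coeff_zero_eq_eval_zero]
  · have h1 := h d (by omega)
    rw [Polynomial.coeff_derivative] at h1
    exact (mul_eq_zero.1 h1).resolve_right (by positivity)

/-- A polynomial that joins the zero function with smoothness `r` at the origin is divisible by
`T ^ (r + 1)`. -/
theorem X_pow_dvd_of_contDiffAt {r : ℕ} {d : ℝ → ℝ} {q : Polynomial ℝ}
    (hd : ContDiffAt ℝ r d 0) (hright : ∀ᶠ t in nhdsWithin 0 (Set.Ioi 0), d t = 0)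
    (hleft : ∀ᶠ t in nhdsWithin 0 (Set.Iio 0), d t = q.eval t) :
    Polynomial.X ^ (r + 1) ∣ q := by
  have hq0 : ∀ {d : ℝ → ℝ} {q : Polynomial ℝ}, ContinuousAt d 0 →
      (∀ᶠ t in nhdsWithin 0 (Set.Ioi 0), d t = 0) →
      (∀ᶠ t in nhdsWithin 0 (Set.Iio 0), d t = q.eval t) → q.eval 0 = 0 := by
    intro d q hc hr hl
    have h1 : d 0 = 0 := tendsto_nhds_unique_of_eventuallyEq
      (hc.tendsto.mono_left nhdsWithin_le_nhds) (tendsto_const_nhds (f := nhdsWithin 0 (Set.Ioi 0)))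
      hr
    have h2 : d 0 = q.eval 0 := tendsto_nhds_unique_of_eventuallyEq
      (hc.tendsto.mono_left nhdsWithin_le_nhds)
      (q.continuous.continuousAt.tendsto.mono_left nhdsWithin_le_nhds) hl
    rw [← h2, h1]
  induction r generalizing d q with
  | zero =>
    refine X_pow_succ_dvd_of_derivative (hq0 hd.continuousAt hright hleft) ?_
    simp
  | succ r ih =>
    refine X_pow_succ_dvd_of_derivative (hq0 hd.continuousAt hright hleft) ?_
    have hd' : ContDiffAt ℝ r (deriv d) 0 := by
      have h1 : ContDiffAt ℝ r (fderiv ℝ d) 0 := hd.fderiv_right (by norm_cast)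
      exact h1.clm_apply contDiffAt_const
    refine ih hd' ?_ ?_
    · filter_upwards [eventually_eventually_nhdsWithin.2 hright, self_mem_nhdsWithin] with t ht ht0
      rw [isOpen_Ioi.nhdsWithin_eq ht0] at ht
      have h1 : d =ᶠ[nhds t] fun _ => 0 := ht
      rw [h1.deriv_eq, deriv_const]
    · filter_upwards [eventually_eventually_nhdsWithin.2 hleft, self_mem_nhdsWithin] with t ht ht0
      rw [isOpen_Iio.nhdsWithin_eq ht0] at ht
      have h1 : d =ᶠ[nhds t] fun t => q.eval t := ht
      rw [h1.deriv_eq, Polynomial.deriv]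

theorem MvPolynomial.hasFDerivAt_eval (p : MvPolynomial (Fin n) ℝ) (y : Fin n → ℝ) :
    HasFDerivAt (fun y => eval y p)
      (∑ a, eval y (pderiv a p) • (ContinuousLinearMap.proj a : (Fin n → ℝ) →L[ℝ] ℝ)) y := by
  induction p using MvPolynomial.induction_on with
  | C c => simpa using hasFDerivAt_const c y
  | add p q hp hq =>
    convert! hp.add hq using 1
    · ext; simp
    · simp [add_smul, Finset.sum_add_distrib]
  | mul_X p b hp =>
    convert! hp.mul (ContinuousLinearMap.proj b : (Fin n → ℝ) →L[ℝ] ℝ).hasFDerivAt using 1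
    · ext; simp
    · simp only [pderiv_mul, pderiv_X, map_add, map_mul, eval_X, add_smul, Finset.sum_add_distrib,
        Finset.smul_sum, smul_smul]
      rw [add_comm]
      congr 1
      · rw [Finset.sum_eq_single b]
        · simp
        · intro a _ ha
          simp [Pi.single_eq_of_ne ha.symm]
        · simp
      · exact Finset.sum_congr rfl fun a _ => by rw [mul_comm]; rfl

end PolynomialFunctions

section Smoothness

variable {n : ℕ}

/-- The cone on which the `i`-th linear form is minimal. -/
def braidCone (i : Fin (n + 1)) : Set (Fin n → ℝ) :=
  {y | ∀ j, eval y (braidForm n i) ≤ eval y (braidForm n j)}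

theorem isClosed_braidCone (i : Fin (n + 1)) : IsClosed (braidCone i) := by
  simp only [braidCone, Set.ofPred_forall]
  exact isClosed_iInter fun j =>
    isClosed_le (MvPolynomial.continuous_eval _) (MvPolynomial.continuous_eval _)

theorem exists_mem_braidCone (y : Fin n → ℝ) : ∃ i, y ∈ braidCone i :=
  Finite.exists_min fun i => eval y (braidForm n i)

/-- The function that agrees with `p i` on the `i`-th cone. -/
def braidPiecewise (p : Fin (n + 1) → MvPolynomial (Fin n) ℝ) (y : Fin n → ℝ) : ℝ :=
  eval y (p (exists_mem_braidCone y).choose)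

theorem BraidCompatible.eval_eq {K : ℕ} {p : Fin (n + 1) → MvPolynomial (Fin n) ℝ}
    (hp : BraidCompatible (K + 1) p) {y : Fin n → ℝ} {i j : Fin (n + 1)} (hi : y ∈ braidCone i)
    (hj : y ∈ braidCone j) : eval y (p i) = eval y (p j) := by
  obtain ⟨q, hq⟩ := hp i j
  have h := congrArg (eval y) hq
  rw [map_mul, map_pow, map_sub, map_sub, le_antisymm (hi j) (hj i), sub_self,
    zero_pow K.succ_ne_zero, zero_mul] at h
  exact sub_eq_zero.1 h

theorem BraidCompatible.braidPiecewise_eq {K : ℕ} {p : Fin (n + 1) → MvPolynomial (Fin n) ℝ}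
    (hp : BraidCompatible (K + 1) p) {y : Fin n → ℝ} {i : Fin (n + 1)} (hi : y ∈ braidCone i) :
    braidPiecewise p y = eval y (p i) :=
  hp.eval_eq (exists_mem_braidCone y).choose_spec hi

theorem pow_dvd_pderiv {σ : Type*} {l f : MvPolynomial σ ℝ} {N : ℕ} (a : σ)
    (h : l ^ (N + 1) ∣ f) : l ^ N ∣ pderiv a f := by
  obtain ⟨q, rfl⟩ := h
  rw [pderiv_mul, pderiv_pow, Nat.add_sub_cancel, pow_succ]
  exact ⟨((N + 1 : ℕ) : MvPolynomial σ ℝ) * MvPolynomial.pderiv a l * q +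
    l * MvPolynomial.pderiv a q, by ring⟩

theorem BraidCompatible.pderiv {K : ℕ} {p : Fin (n + 1) → MvPolynomial (Fin n) ℝ}
    (hp : BraidCompatible (K + 1) p) (a : Fin n) :
    BraidCompatible K fun i => MvPolynomial.pderiv a (p i) := fun i j => by
  simpa only [map_sub] using pow_dvd_pderiv a (hp i j)

theorem BraidCompatible.hasFDerivAt {K : ℕ} {p : Fin (n + 1) → MvPolynomial (Fin n) ℝ}
    (hp : BraidCompatible (K + 2) p) (y : Fin n → ℝ) :
    HasFDerivAt (braidPiecewise p)
      (∑ a, braidPiecewise (fun i => MvPolynomial.pderiv a (p i)) y •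
        (ContinuousLinearMap.proj a : (Fin n → ℝ) →L[ℝ] ℝ)) y := by
  have hcover : (⋃ i, braidCone i : Set (Fin n → ℝ)) = Set.univ :=
    Set.iUnion_eq_univ_iff.2 exists_mem_braidCone
  rw [← hasFDerivWithinAt_univ, ← hcover, hasFDerivWithinAt_iff_isLittleO, nhdsWithin_iUnion,
    Asymptotics.isLittleO_iff]
  intro c hc
  rw [Filter.eventually_iSup]
  intro i
  refine Asymptotics.isLittleO_iff.1 (hasFDerivWithinAt_iff_isLittleO.1 ?_) hc
  by_cases hi : y ∈ braidCone i
  · have h := ((p i).hasFDerivAt_eval y).hasFDerivWithinAt (s := braidCone i)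
    refine (HasFDerivWithinAt.congr h (fun z hz => hp.braidPiecewise_eq hz)
      (hp.braidPiecewise_eq hi)).congr_fderiv ?_
    exact Finset.sum_congr rfl fun a _ => by rw [(hp.pderiv a).braidPiecewise_eq hi]
  · exact HasFDerivWithinAt.of_notMem_closure (by rwa [(isClosed_braidCone i).closure_eq])

theorem BraidCompatible.contDiff {r : ℕ} {p : Fin (n + 1) → MvPolynomial (Fin n) ℝ}
    (hp : BraidCompatible (r + 1) p) : ContDiff ℝ r (braidPiecewise p) := by
  induction r generalizing p with
  | zero =>
    refine contDiff_zero.2 ((locallyFinite_of_finite braidCone).continuous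
      (Set.iUnion_eq_univ_iff.2 exists_mem_braidCone) isClosed_braidCone fun i => ?_)
    exact (MvPolynomial.continuous_eval (p i)).continuousOn.congr fun y hy =>
      hp.braidPiecewise_eq hy
  | succ r ih =>
    rw [Nat.cast_succ, contDiff_succ_iff_fderiv]
    refine ⟨fun y => (hp.hasFDerivAt y).differentiableAt,
      fun h => absurd h (WithTop.natCast_ne_top r), ?_⟩
    rw [funext fun y => (hp.hasFDerivAt y).fderiv]
    exact ContDiff.sum fun a _ => (ih (hp.pderiv a)).smul contDiff_const

theorem exists_smul_braidPoint_mem {W : Set (Fin n → ℝ)} (hW : W ∈ nhds 0)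
    (c : Fin (n + 1) → ℝ) : ∃ ε : ℝ, 0 < ε ∧ ε • braidPoint c ∈ W := by
  have h : Filter.Tendsto (fun ε : ℝ => ε • braidPoint c) (nhdsWithin 0 (Set.Ioi 0)) (nhds 0) := by
    have h1 : Continuous fun ε : ℝ => ε • braidPoint c := by fun_prop
    simpa using (h1.tendsto 0).mono_left (nhdsWithin_le_nhds (s := Set.Ioi 0))
  obtain ⟨ε, hε, hpos⟩ := ((h.eventually_mem hW).and self_mem_nhdsWithin).exists
  exact ⟨ε, hpos, hε⟩

theorem eval_smul_braidPoint (c : Fin (n + 1) → ℝ) (ε : ℝ) (i : Fin (n + 1)) :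
    eval (ε • braidPoint c) (braidForm n i) = ε * (c i - c 0) := by
  have h := eval_add_smul_braidForm 0 c ε i
  have h0 : eval (0 : Fin n → ℝ) (braidForm n i) = 0 := by
    cases i using Fin.cases <;> simp
  rwa [zero_add, h0, zero_add] at h

theorem eq_zero_of_forall_mem_braidCone {W : Set (Fin n → ℝ)} (hW : IsOpen W)
    (h0 : (0 : Fin n → ℝ) ∈ W) {i : Fin (n + 1)} {p : MvPolynomial (Fin n) ℝ}
    (hp : ∀ y ∈ W ∩ braidCone i, eval y p = 0) : p = 0 := by
  obtain ⟨ε, hε, hmem⟩ := exists_smul_braidPoint_mem (hW.mem_nhds h0)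
    (fun j => if j = i then 0 else 1 : Fin (n + 1) → ℝ)
  refine MvPolynomial.eq_zero_of_forall_mem_isOpen
    (U := W ∩ ⋂ j, ⋂ (_ : j ≠ i), {y | eval y (braidForm n i) < eval y (braidForm n j)})
    (hW.inter (isOpen_iInter_of_finite fun j => isOpen_iInter_of_finite fun _ =>
      isOpen_lt (MvPolynomial.continuous_eval _) (MvPolynomial.continuous_eval _)))
    ⟨_, hmem, ?_⟩ fun y hy => hp y ⟨hy.1, fun j => ?_⟩
  · simp only [Set.mem_iInter, Set.mem_ofPred_eq, eval_smul_braidPoint]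
    intro j hj
    rw [if_pos trivial, if_neg hj]
    exact mul_lt_mul_of_pos_left (by linarith) hε
  · rcases eq_or_ne j i with rfl | hj
    · exact le_rfl
    · have h := hy.2
      simp only [Set.mem_iInter, Set.mem_ofPred_eq] at h
      exact (h j hj).le

theorem braidCompatible_of_contDiffOn {r : ℕ} {G : (Fin n → ℝ) → ℝ} {W : Set (Fin n → ℝ)}
    (hW : IsOpen W) (h0 : (0 : Fin n → ℝ) ∈ W) (hG : ContDiffOn ℝ r G W)
    {q : Fin (n + 1) → MvPolynomial (Fin n) ℝ}
    (hq : ∀ i, ∀ y ∈ W ∩ braidCone i, G y = eval y (q i)) : BraidCompatible (r + 1) q := by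
  intro i j
  rcases eq_or_ne i j with rfl | hij
  · simp
  set w : Fin n → ℝ := braidPoint (Pi.single i 1) with hw
  set V : Set (Fin n → ℝ) := braidProj i j ⁻¹' (W ∩ ⋂ m, ⋂ (_ : m ≠ i), ⋂ (_ : m ≠ j),
    {y | eval y (braidForm n i) < eval y (braidForm n m)}) with hV
  have hVo : IsOpen V := (hW.inter (isOpen_iInter_of_finite fun m =>
    isOpen_iInter_of_finite fun _ => isOpen_iInter_of_finite fun _ =>
      isOpen_lt (MvPolynomial.continuous_eval _) (MvPolynomial.continuous_eval _))).preimage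
    (continuous_braidProj i j)
  have hVne : V.Nonempty := by
    obtain ⟨ε, hε, hmem⟩ := exists_smul_braidPoint_mem (hW.mem_nhds h0)
      (fun m => if m = i ∨ m = j then 0 else 1 : Fin (n + 1) → ℝ)
    refine ⟨ε • braidPoint (fun m => if m = i ∨ m = j then 0 else 1 : Fin (n + 1) → ℝ), ?_⟩
    have hfix : braidProj i j
        (ε • braidPoint (fun m => if m = i ∨ m = j then 0 else 1 : Fin (n + 1) → ℝ)) =
        ε • braidPoint (fun m => if m = i ∨ m = j then 0 else 1 : Fin (n + 1) → ℝ) := by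
      simp [braidProj, eval_smul_braidPoint]
    rw [hV, Set.mem_preimage, hfix]
    refine ⟨hmem, ?_⟩
    simp only [Set.mem_iInter, Set.mem_ofPred_eq, eval_smul_braidPoint]
    intro m hmi hmj
    rw [if_pos (Or.inl trivial), if_neg (not_or.2 ⟨hmi, hmj⟩)]
    exact mul_lt_mul_of_pos_left (by linarith) hε
  refine braidForm_sub_pow_dvd hij hVo hVne _ _ fun y hy => ?_
  set z := braidProj i j y with hz
  have hzW : z ∈ W := hy.1
  have hzm : ∀ m, m ≠ i → m ≠ j → eval z (braidForm n i) < eval z (braidForm n m) := by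
    have h := hy.2
    simp only [Set.mem_iInter, Set.mem_ofPred_eq] at h
    exact h
  have hzij : eval z (braidForm n i) = eval z (braidForm n j) := eval_braidProj hij y
  have hline : Continuous fun t : ℝ => z + t • w := by fun_prop
  have hnhds : ∀ U : Set (Fin n → ℝ), IsOpen U → z ∈ U → ∀ᶠ t : ℝ in nhds 0, z + t • w ∈ U :=
    fun U hU hzU => hline.continuousAt.eventually_mem (by simpa using hU.mem_nhds hzU)
  have hev : ∀ᶠ t : ℝ in nhds 0, z + t • w ∈ W ∧ ∀ m, m ≠ i → m ≠ j →
      eval (z + t • w) (braidForm n i) < eval (z + t • w) (braidForm n m) ∧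
      eval (z + t • w) (braidForm n j) < eval (z + t • w) (braidForm n m) := by
    refine (hnhds W hW hzW).and ?_
    rw [Filter.eventually_all]
    intro m
    by_cases hm : m ≠ i ∧ m ≠ j
    · have h1 := hnhds {y | eval y (braidForm n i) < eval y (braidForm n m)}
        (isOpen_lt (MvPolynomial.continuous_eval _) (MvPolynomial.continuous_eval _))
        (hzm m hm.1 hm.2)
      have h2 := hnhds {y | eval y (braidForm n j) < eval y (braidForm n m)}
        (isOpen_lt (MvPolynomial.continuous_eval _) (MvPolynomial.continuous_eval _))
        (by rw [Set.mem_ofPred_eq, ← hzij]; exact hzm m hm.1 hm.2)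
      filter_upwards [h1, h2] with t ht1 ht2 _ _
      exact ⟨ht1, ht2⟩
    · exact Filter.Eventually.of_forall fun t h1 h2 => absurd ⟨h1, h2⟩ hm
  have hdiff : ∀ t : ℝ, eval (z + t • w) (braidForm n i) - eval (z + t • w) (braidForm n j) = t :=
    fun t => by
      rw [hw, eval_add_smul_braidForm, eval_add_smul_braidForm, hzij, Pi.single_eq_same,
        Pi.single_eq_of_ne hij.symm]
      ring
  have hGd : ContDiffAt ℝ r (fun t : ℝ => G (z + t • w) - eval (z + t • w) (q j)) 0 := by
    have h1 : ContDiff ℝ r fun t : ℝ => z + t • w := by fun_prop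
    have h2 : ContDiff ℝ r fun t : ℝ => eval (z + t • w) (q j) := by
      simp only [← eval_lineRestrict]
      simpa using Polynomial.contDiff_aeval (𝕜 := ℝ) (lineRestrict z w (q j)) r
    refine ContDiffAt.sub ?_ h2.contDiffAt
    refine ContDiffAt.comp (0 : ℝ) (g := G) ?_ h1.contDiffAt
    simpa using hG.contDiffAt (hW.mem_nhds hzW)
  refine X_pow_dvd_of_contDiffAt hGd ?_ ?_
  · filter_upwards [hev.filter_mono nhdsWithin_le_nhds, self_mem_nhdsWithin] with t ht ht0
    rw [sub_eq_zero]
    refine hq j _ ⟨ht.1, fun m => ?_⟩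
    rcases eq_or_ne m j with rfl | hmj
    · exact le_rfl
    rcases eq_or_ne m i with rfl | hmi
    · have := hdiff t
      have : 0 < t := ht0
      linarith
    · exact (ht.2 m hmi hmj).2.le
  · filter_upwards [hev.filter_mono nhdsWithin_le_nhds, self_mem_nhdsWithin] with t ht ht0
    rw [eval_lineRestrict, map_sub]
    congr 1
    refine hq i _ ⟨ht.1, fun m => ?_⟩
    rcases eq_or_ne m i with rfl | hmi
    · exact le_rfl
    rcases eq_or_ne m j with rfl | hmj
    · have := hdiff t
      have : t < 0 := ht0
      linarith
    · exact (ht.2 m hmi hmj).1.le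

end Smoothness

section Substitution

variable {σ τ : Type*}

theorem totalDegree_bind₁_le {a : σ → MvPolynomial τ ℝ} (ha : ∀ i, (a i).totalDegree ≤ 1)
    (p : MvPolynomial σ ℝ) : (bind₁ a p).totalDegree ≤ p.totalDegree := by
  rw [bind₁, aeval_def, eval₂_eq]
  refine totalDegree_finsetSum_le fun d hd => ?_
  refine (totalDegree_mul _ _).trans ?_
  rw [algebraMap_eq, totalDegree_C, zero_add]
  refine (totalDegree_finsetProd _ _).trans (le_trans ?_ (le_totalDegree hd))
  refine Finset.sum_le_sum fun i _ => (totalDegree_pow _ _).trans ?_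
  simpa using Nat.mul_le_mul_left (d i) (ha i)

theorem eval_bind₁ (a : σ → MvPolynomial τ ℝ) (x : τ → ℝ) (p : MvPolynomial σ ℝ) :
    eval x (bind₁ a p) = eval (fun i => eval x (a i)) p := by
  rw [← coe_aeval_eq_eval, ← coe_aeval_eq_eval, RingHom.coe_coe, RingHom.coe_coe, aeval_bind₁]

theorem exists_totalDegree_le_one {n : ℕ} (f : (Fin n → ℝ) →ᵃ[ℝ] ℝ) :
    ∃ p : MvPolynomial (Fin n) ℝ, p.totalDegree ≤ 1 ∧ ∀ x, f x = eval x p := by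
  refine ⟨C (f 0) + ∑ a, C (f.linear (Pi.single a 1)) * X a, ?_, fun x => ?_⟩
  · refine (totalDegree_add _ _).trans (max_le (by simp) (totalDegree_finsetSum_le fun a _ => ?_))
    exact (totalDegree_mul _ _).trans (by simp)
  · have h := f.map_vadd 0 x
    rw [vadd_eq_add, vadd_eq_add, add_zero] at h
    have hsingle : ∀ a : Fin n, (fun c => if a = c then 1 else 0 : Fin n → ℝ) = Pi.single a 1 :=
      fun a => by
        funext c
        simp only [Pi.single_apply, eq_comm]
    rw [h, add_comm, f.linear.pi_apply_eq_sum_univ]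
    simp [mul_comm, hsingle]

end Substitution

section Geometry

variable {n : ℕ}

/-- The affine coordinates in which the cells of the Alfeld split become the cones of the braid
arrangement. -/
def toBraid (b : AffineBasis (Fin (n + 1)) ℝ (Fin n → ℝ)) (v x : Fin n → ℝ) : Fin n → ℝ :=
  braidPoint fun i => b.coord i x / b.coord i v

/-- The barycentric coordinates of the point with given braid coordinates. -/
def braidWeight (b : AffineBasis (Fin (n + 1)) ℝ (Fin n → ℝ)) (v y : Fin n → ℝ)
    (i : Fin (n + 1)) : ℝ :=
  b.coord i v * (eval y (braidForm n i) + (1 - ∑ m, b.coord m v * eval y (braidForm n m)))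

/-- The inverse of `toBraid`. -/
def ofBraid (b : AffineBasis (Fin (n + 1)) ℝ (Fin n → ℝ)) (v y : Fin n → ℝ) : Fin n → ℝ :=
  ∑ i, braidWeight b v y i • b i

variable (b : AffineBasis (Fin (n + 1)) ℝ (Fin n → ℝ)) {v : Fin n → ℝ}

theorem sum_braidWeight (y : Fin n → ℝ) : ∑ i, braidWeight b v y i = 1 := by
  simp only [braidWeight, mul_add, Finset.sum_add_distrib, ← Finset.sum_mul,
    b.sum_coord_apply_eq_one]
  ring

theorem coord_ofBraid (y : Fin n → ℝ) (i : Fin (n + 1)) :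
    b.coord i (ofBraid b v y) = braidWeight b v y i := by
  rw [ofBraid, ← Finset.univ.affineCombination_eq_linear_combination _ _ (sum_braidWeight b y)]
  exact b.coord_apply_combination_of_mem (Finset.mem_univ i) (sum_braidWeight b y)

theorem toBraid_ofBraid (hv : ∀ i, 0 < b.coord i v) (y : Fin n → ℝ) :
    toBraid b v (ofBraid b v y) = y := by
  funext a
  simp only [toBraid, braidPoint, coord_ofBraid, braidWeight]
  rw [mul_div_cancel_left₀ _ (hv _).ne', mul_div_cancel_left₀ _ (hv _).ne']
  simp

theorem ofBraid_toBraid (hv : ∀ i, 0 < b.coord i v) (x : Fin n → ℝ) :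
    ofBraid b v (toBraid b v x) = x := by
  refine b.ext_elem fun i => ?_
  simp only [coord_ofBraid, braidWeight, toBraid, eval_braidPoint, mul_sub, Finset.sum_sub_distrib,
    mul_div_cancel₀ _ (hv _).ne', ← Finset.sum_mul, b.sum_coord_apply_eq_one]
  have h := (hv i).ne'
  field_simp
  ring

theorem ofBraid_zero : ofBraid b v 0 = v := by
  refine b.ext_elem fun i => ?_
  have h : ∀ j, eval (0 : Fin n → ℝ) (braidForm n j) = 0 := fun j => by
    cases j using Fin.cases <;> simp
  simp only [coord_ofBraid, braidWeight, h]
  simp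

theorem exists_eval_toBraid : ∃ a : Fin n → MvPolynomial (Fin n) ℝ,
    (∀ c, (a c).totalDegree ≤ 1) ∧ ∀ x, toBraid b v x = fun c => eval x (a c) := by
  choose p hp hpe using fun i => exists_totalDegree_le_one (b.coord i)
  refine ⟨fun c => C (b.coord c.succ v)⁻¹ * p c.succ - C (b.coord 0 v)⁻¹ * p 0, fun c => ?_,
    fun x => ?_⟩
  · refine (totalDegree_sub _ _).trans (max_le ?_ ?_) <;>
      exact (totalDegree_mul _ _).trans (by simpa using hp _)
  · funext c
    simp [toBraid, braidPoint, hpe, div_eq_inv_mul]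

theorem exists_eval_ofBraid : ∃ a : Fin n → MvPolynomial (Fin n) ℝ,
    (∀ c, (a c).totalDegree ≤ 1) ∧ ∀ y, ofBraid b v y = fun c => eval y (a c) := by
  refine ⟨fun c => ∑ i, C (b i c * b.coord i v) *
    (braidForm n i + (1 - ∑ m, C (b.coord m v) * braidForm n m)), fun c => ?_, fun y => ?_⟩
  · refine totalDegree_finsetSum_le fun i _ => (totalDegree_mul _ _).trans ?_
    rw [totalDegree_C, zero_add]
    refine (totalDegree_add _ _).trans (max_le (totalDegree_braidForm_le i)
      ((totalDegree_sub _ _).trans (max_le (by simp)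
        (totalDegree_finsetSum_le fun m _ => (totalDegree_mul _ _).trans ?_))))
    simpa using totalDegree_braidForm_le m
  · funext c
    simp only [ofBraid, braidWeight, Finset.sum_apply, Pi.smul_apply, smul_eq_mul, map_sum,
      map_mul, map_add, map_sub, map_one, eval_C]
    exact Finset.sum_congr rfl fun i _ => by ring

theorem toBraid_mem_braidCone {x : Fin n → ℝ} {i : Fin (n + 1)} :
    toBraid b v x ∈ braidCone i ↔
      ∀ j, b.coord i x / b.coord i v ≤ b.coord j x / b.coord j v := by
  simp [braidCone, toBraid]

theorem alfeldCell_subset (hv : v ∈ convexHull ℝ (Set.range b)) (i : Fin (n + 1)) :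
    alfeldCell b v i ⊆ convexHull ℝ (Set.range b) :=
  convexHull_min (Set.union_subset (Set.singleton_subset_iff.2 hv)
    ((Set.image_subset_range _ _).trans (subset_convexHull ℝ _))) (convex_convexHull ℝ _)

theorem mem_alfeldCell_iff (hv : ∀ i, 0 < b.coord i v) {x : Fin n → ℝ}
    (hx : x ∈ convexHull ℝ (Set.range b)) (i : Fin (n + 1)) :
    x ∈ alfeldCell b v i ↔ toBraid b v x ∈ braidCone i := by
  rw [toBraid_mem_braidCone]
  constructor
  · have hconv : Convex ℝ {x | ∀ j, b.coord i x / b.coord i v ≤ b.coord j x / b.coord j v} := by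
      have h : ∀ j, Convex ℝ ((fun x => b.coord j x / b.coord j v - b.coord i x / b.coord i v) ⁻¹'
          Set.Ici 0) := fun j => by
        have := (convex_Ici (0 : ℝ)).affine_preimage
          ((b.coord j v)⁻¹ • b.coord j - (b.coord i v)⁻¹ • b.coord i)
        convert! this using 2
        funext x
        simp [div_eq_inv_mul]
      have h' := convex_iInter h
      convert! h' using 1
      ext x
      simp
    refine fun h => convexHull_min ?_ hconv h
    rintro _ (rfl | ⟨m, hm, rfl⟩) j
    · rw [div_self (hv _).ne', div_self (hv _).ne']
    · rw [b.coord_apply_ne hm.symm, zero_div, b.coord_apply]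
      have := hv j
      split_ifs <;> positivity
  · intro h
    rw [b.convexHull_eq_nonneg_coord] at hx
    set μ := b.coord i x / b.coord i v with hμ
    have hμi : μ * b.coord i v = b.coord i x := div_mul_cancel₀ _ (hv i).ne'
    set w : Fin (n + 1) → ℝ := fun j => b.coord j x - μ * b.coord j v with hw
    have hw0 : ∀ j, 0 ≤ w j := fun j => by
      have := (le_div_iff₀ (hv j)).1 (h j)
      simpa [hw] using this
    have hwi : w i = 0 := by simp [hw, hμi]
    have hsum : μ + ∑ j, w j = 1 := by
      simp only [hw, Finset.sum_sub_distrib, ← Finset.mul_sum, b.sum_coord_apply_eq_one]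
      ring
    have hxs : x = μ • v + ∑ j, w j • b j := by
      simp only [hw, sub_smul, mul_smul, Finset.sum_sub_distrib, ← Finset.smul_sum,
        b.linear_combination_coord_eq_self]
      abel
    have hz : ∀ j, (if j = i then v else b j) ∈ alfeldCell b v i := fun j => by
      refine subset_convexHull ℝ _ ?_
      split_ifs with hj
      · exact Or.inl rfl
      · exact Or.inr ⟨j, hj, rfl⟩
    have hmem := (convex_convexHull ℝ ({v} ∪ b '' {j | j ≠ i})).sum_mem (t := Finset.univ)
      (w := fun j => w j + if j = i then μ else 0)
      (fun j _ => add_nonneg (hw0 j) (by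
        split_ifs
        · exact div_nonneg (hx i) (hv i).le
        · exact le_rfl))
      (by rw [Finset.sum_add_distrib, Finset.sum_ite_eq' Finset.univ i, if_pos (Finset.mem_univ i),
        add_comm, hsum])
      (fun j _ => hz j)
    convert! hmem using 1
    rw [hxs, Finset.sum_congr rfl (fun j _ => add_smul _ _ _), Finset.sum_add_distrib, add_comm]
    congr 1
    · refine Finset.sum_congr rfl fun j _ => ?_
      split_ifs with hj
      · rw [hj, hwi, zero_smul, zero_smul]
      · rfl
    · rw [Finset.sum_eq_single i (fun j _ hj => by simp [hj]) (by simp)]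
      simp

end Geometry

section Comparison

variable {n : ℕ}

theorem contDiff_eval {r : ℕ} (p : MvPolynomial (Fin n) ℝ) :
    ContDiff ℝ r fun x : Fin n → ℝ => eval x p :=
  (AnalyticOnNhd.eval_mvPolynomial p).contDiff

/-- The spline on the Alfeld split that corresponds to a compatible tuple of polynomials. -/
def braidSplinesToFun (b : AffineBasis (Fin (n + 1)) ℝ (Fin n → ℝ)) (v : Fin n → ℝ) (m K : ℕ) :
    braidSplines n m K →ₗ[ℝ] ((convexHull ℝ (Set.range b) : Set (Fin n → ℝ)) → ℝ) where
  toFun p x := braidPiecewise p.1 (toBraid b v x)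
  map_add' p q := by
    funext x
    simp [braidPiecewise]
  map_smul' c p := by
    funext x
    simp [braidPiecewise, smul_eval]

variable (b : AffineBasis (Fin (n + 1)) ℝ (Fin n → ℝ)) {v : Fin n → ℝ}

theorem isOpen_preimage_ofBraid :
    IsOpen (ofBraid b v ⁻¹' interior (convexHull ℝ (Set.range b))) := by
  obtain ⟨a, -, ha⟩ := exists_eval_ofBraid b (v := v)
  refine isOpen_interior.preimage ?_
  rw [funext ha]
  exact continuous_pi fun c => MvPolynomial.continuous_eval (a c)

theorem braidSplinesToFun_injective (hv : v ∈ interior (convexHull ℝ (Set.range b))) (m K : ℕ) :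
    Function.Injective (braidSplinesToFun b v m K) := by
  have hv' : ∀ i, 0 < b.coord i v := by simpa [b.interior_convexHull] using hv
  refine (injective_iff_map_eq_zero _).2 fun p hp => Subtype.ext (funext fun i => ?_)
  refine eq_zero_of_forall_mem_braidCone (isOpen_preimage_ofBraid b (v := v))
    (by rwa [Set.mem_preimage, ofBraid_zero]) (i := i) fun y hy => ?_
  have h := congrFun hp ⟨ofBraid b v y, interior_subset hy.1⟩
  rw [← BraidCompatible.braidPiecewise_eq p.2.2 hy.2]
  simpa [braidSplinesToFun, toBraid_ofBraid b hv'] using h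

theorem range_braidSplinesToFun (hv : v ∈ interior (convexHull ℝ (Set.range b))) (m K : ℕ) :
    LinearMap.range (braidSplinesToFun b v m K) = alfeldSplines n (2 * m + 1) K b v := by
  have hv' : ∀ i, 0 < b.coord i v := by simpa [b.interior_convexHull] using hv
  obtain ⟨a, ha1, ha⟩ := exists_eval_toBraid b (v := v)
  obtain ⟨a', ha1', ha'⟩ := exists_eval_ofBraid b (v := v)
  apply le_antisymm
  · rintro _ ⟨⟨p, hdeg, hp⟩, rfl⟩
    refine ⟨fun x => braidPiecewise p (toBraid b v x), ?_, fun x => rfl, fun i =>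
      ⟨bind₁ a (p i), (totalDegree_bind₁_le ha1 _).trans (hdeg i), fun x hx => ?_⟩⟩
    · have hsmooth : ContDiff ℝ (2 * m + 1 : ℕ) (toBraid b v) := by
        rw [funext ha]
        exact contDiff_pi.2 fun c => contDiff_eval (a c)
      exact (hp.contDiff.comp hsmooth).contDiffOn
    · have hx' := (mem_alfeldCell_iff b hv' (alfeldCell_subset b (interior_subset hv) i hx) i).1 hx
      refine (hp.braidPiecewise_eq hx').trans ?_
      rw [eval_bind₁, ← ha]
  · rintro f ⟨F, hF, hfF, hFp⟩
    choose p hdeg hpe using hFp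
    have hq : BraidCompatible (2 * m + 1 + 1) fun i => bind₁ a' (p i) := by
      refine braidCompatible_of_contDiffOn (G := fun y => F (ofBraid b v y))
        (isOpen_preimage_ofBraid b (v := v)) (by rwa [Set.mem_preimage, ofBraid_zero]) ?_
        fun i y hy => ?_
      · have hsmooth : ContDiff ℝ (2 * m + 1 : ℕ) (ofBraid b v) := by
          rw [funext ha']
          exact contDiff_pi.2 fun c => contDiff_eval (a' c)
        exact hF.comp hsmooth.contDiffOn fun y hy => interior_subset hy
      · rw [eval_bind₁, ← ha']
        refine hpe i _ ((mem_alfeldCell_iff b hv' (interior_subset hy.1) i).2 ?_)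
        rw [toBraid_ofBraid b hv']
        exact hy.2
    refine ⟨⟨fun i => bind₁ a' (p i),
      fun i => (totalDegree_bind₁_le ha1' _).trans (hdeg i), hq⟩, funext fun x => ?_⟩
    obtain ⟨i, hi⟩ := exists_mem_braidCone (toBraid b v x)
    rw [hfF x, hpe i x ((mem_alfeldCell_iff b hv' x.2 i).2 hi)]
    refine (hq.braidPiecewise_eq hi).trans ?_
    rw [eval_bind₁, ← ha', ofBraid_toBraid b hv']

end Comparison

/-- **Conjecture of Foucart–Sorokina, odd case** (proved by Schenck): for `r` odd, the dimension
of `C^r_k(AS(Δ_n))` is `binom(k+n, n) + n * binom(k + n - (r+1)(n+1)/2, n)` (where, thanks to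
truncated subtraction, `binom(a, n) = 0` whenever the integer `k + n - (r+1)(n+1)/2 < n`). -/
theorem dim_alfeldSplines_odd (n r k : ℕ) (hn : 1 ≤ n) (hr : Odd r)
    (e : Fin (n + 1) → Fin n → ℝ) (he : AffineIndependent ℝ e)
    (v : Fin n → ℝ) (hv : v ∈ interior (convexHull ℝ (Set.range e))) :
    Module.finrank ℝ (alfeldSplines n r k e v) =
      (k + n).choose n + n * ((k + n - (r + 1) * (n + 1) / 2).choose n) := by
  obtain ⟨m, rfl⟩ := hr
  have htop : affineSpan ℝ (Set.range e) = ⊤ :=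
    he.affineSpan_eq_top_iff_card_eq_finrank_add_one.2 (by simp)
  have hrange := range_braidSplinesToFun ⟨e, he, htop⟩ hv m k
  have hinj := braidSplinesToFun_injective ⟨e, he, htop⟩ hv m k
  have hexp : (2 * m + 1 + 1) * (n + 1) / 2 = (m + 1) * (n + 1) := by
    rw [show (2 * m + 1 + 1) * (n + 1) = 2 * ((m + 1) * (n + 1)) by ring]
    exact Nat.mul_div_cancel_left _ two_pos
  rw [hexp, ← finrank_braidSplines hn, ← LinearMap.finrank_range_of_inj hinj, hrange]
  rfl

end
end

section
/- Let ℓ be a nonzero affine-linear function on ℝ^n, let r ≥ 0, and let f, g be polynomial functions on ℝ^n. Define F : ℝ^n → ℝ by F(p) = f(p) if ℓ(p) > 0 and F(p) = g(p) if ℓ(p) ≤ 0. Then F is r-times continuously differentiable on ℝ^n if and only if ℓ^{r+1} divides f − g in the polynomial ring ℝ[x_1, …, x_n]. -/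
open MvPolynomial

open Filter Topology

theorem hasDerivAt_max_zero_pow (k : ℕ) (x : ℝ) :
    HasDerivAt (fun t : ℝ => max t 0 ^ (k + 2)) ((k + 2 : ℝ) * max x 0 ^ (k + 1)) x := by
  have off_zero : ∀ y : ℝ, y ≠ 0 →
      HasDerivAt (fun t : ℝ => max t 0 ^ (k + 2)) ((k + 2 : ℝ) * max y 0 ^ (k + 1)) y := by
    intro y hy
    rcases lt_or_gt_of_ne hy with hy | hy
    · rw [max_eq_right hy.le, zero_pow (Nat.succ_ne_zero k), mul_zero]
      refine (hasDerivAt_const y (0 : ℝ)).congr_of_eventuallyEq ?_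
      filter_upwards [Iio_mem_nhds hy] with t ht
      simp [max_eq_right (Set.mem_Iio.1 ht).le]
    · rw [max_eq_left hy.le]
      have h := hasDerivAt_pow (k + 2) y
      push_cast at h
      refine h.congr_of_eventuallyEq ?_
      filter_upwards [Ioi_mem_nhds hy] with t ht
      simp [max_eq_left (Set.mem_Ioi.1 ht).le]
  rcases eq_or_ne x 0 with rfl | hx
  · exact hasDerivAt_of_hasDerivAt_of_ne (g := fun y : ℝ => (k + 2 : ℝ) * max y 0 ^ (k + 1))
      off_zero (by fun_prop) (by fun_prop)
  · exact off_zero x hx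

theorem contDiff_max_zero_pow (r : ℕ) : ContDiff ℝ r (fun t : ℝ => max t 0 ^ (r + 1)) := by
  induction r with
  | zero => exact contDiff_zero.2 (by fun_prop)
  | succ r ih =>
    push_cast
    refine contDiff_succ_iff_deriv.2
      ⟨fun x => (hasDerivAt_max_zero_pow r x).differentiableAt, by simp, ?_⟩
    rw [funext fun x => (hasDerivAt_max_zero_pow r x).deriv]
    exact contDiff_const.mul ih

theorem eq_zero_of_contDiff_ite_pow_mul {k : ℕ} {u : ℝ → ℝ} (hu : ContinuousAt u 0)
    (h : ContDiff ℝ k (fun t : ℝ => if 0 < t then t ^ k * u t else 0)) : u 0 = 0 := by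
  set φ : ℝ → ℝ := fun t => if 0 < t then t ^ k * u t else 0 with hφ
  have iteratedDeriv_zero : ∀ i ≤ k, iteratedDeriv i φ 0 = 0 := by
    intro i hi
    have hcont : Continuous (iteratedDeriv i φ) :=
      h.continuous_iteratedDeriv i (by exact_mod_cast hi)
    have hneg : Set.EqOn (iteratedDeriv i φ) (fun _ => 0) (Set.Iio 0) := by
      have hφ_neg : Set.EqOn φ (fun _ => 0) (Set.Iio 0) := fun t ht =>
        if_neg (not_lt.2 (Set.mem_Iio.1 ht).le)
      intro t ht
      simpa using hφ_neg.iteratedDeriv_of_isOpen isOpen_Iio i ht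
    exact hneg.closure hcont continuous_const (by simp)
  have hT := taylor_tendsto convex_univ (Set.mem_univ (0 : ℝ)) h.contDiffOn
  have hzero : ∀ x, taylorWithinEval φ k Set.univ 0 x = 0 := by
    intro x
    rw [taylor_within_apply]
    refine Finset.sum_eq_zero fun i hi => ?_
    rw [iteratedDerivWithin_univ,
      iteratedDeriv_zero i (Nat.lt_succ_iff.1 (Finset.mem_range.1 hi)), smul_zero]
  simp only [hzero, sub_zero, nhdsWithin_univ, smul_eq_mul] at hT
  have hright : Tendsto u (𝓝[>] 0) (𝓝 0) := by
    refine (hT.mono_left nhdsWithin_le_nhds).congr' ?_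
    filter_upwards [self_mem_nhdsWithin] with t ht
    have ht : 0 < t := ht
    simp only [hφ, if_pos ht]
    field_simp
  exact tendsto_nhds_unique (hu.tendsto.mono_left nhdsWithin_le_nhds) hright

/-- A polynomial vanishing on the zero set of a nonconstant affine-linear form is divisible by
that form. -/
theorem affine_dvd_of_eval_eq_zero {σ K : Type*} [Fintype σ] [Field K] [Infinite K]
    {a : σ → K} (b : K) (ha : a ≠ 0) (q : MvPolynomial σ K)
    (hq : ∀ p : σ → K, (∑ i, a i * p i) + b = 0 → eval p q = 0) :
    ((∑ i, C (a i) * X i) + C b) ∣ q := by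
  classical
  obtain ⟨j, hj⟩ := Function.ne_iff.1 ha
  have hj : a j ≠ 0 := hj
  set ℓ : MvPolynomial σ K := (∑ i, C (a i) * X i) + C b with hℓ
  let s : σ → MvPolynomial σ K := fun i => X i - Pi.single (M := fun _ => MvPolynomial σ K) j (C (a j)⁻¹ * ℓ) i
  have hs : aeval s q = 0 := by
    refine MvPolynomial.funext fun p => ?_
    have : eval p (aeval s q) = eval (fun i => eval p (s i)) q := by
      exact eval₂Hom_bind₁ (RingHom.id K) p s q
    rw [this, map_zero]
    apply hq
    have hsingle : ∀ i, eval p (s i) =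
        p i - Pi.single (M := fun _ => K) j ((a j)⁻¹ * eval p ℓ) i := by
      intro i
      rcases eq_or_ne i j with rfl | hi
      · simp [s]
      · simp [s, hi]
    simp only [hsingle, mul_sub, Finset.sum_sub_distrib, Pi.single_apply, mul_ite, mul_zero,
      Finset.sum_ite_eq', Finset.mem_univ, if_true]
    rw [mul_inv_cancel_left₀ hj]
    simp [hℓ]
  have hmk : (Ideal.Quotient.mkₐ K (Ideal.span {ℓ})).comp (aeval s) =
      Ideal.Quotient.mkₐ K (Ideal.span {ℓ}) := by
    refine MvPolynomial.algHom_ext fun i => ?_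
    simp only [AlgHom.comp_apply, aeval_X, Ideal.Quotient.mkₐ_eq_mk]
    rw [Ideal.Quotient.eq, Ideal.mem_span_singleton]
    rcases eq_or_ne i j with rfl | hi
    · simp [s]
    · simp [s, hi]
  rw [← Ideal.mem_span_singleton, ← Ideal.Quotient.eq_zero_iff_mem]
  have hmk_q := DFunLike.congr_fun hmk q
  rw [AlgHom.comp_apply, hs, map_zero] at hmk_q
  exact hmk_q.symm

theorem contDiff_eval_s7 {σ : Type*} [Fintype σ] (q : MvPolynomial σ ℝ) {m : WithTop ℕ∞} :
    ContDiff ℝ m (fun p : σ → ℝ => eval p q) :=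
  (AnalyticOnNhd.eval_mvPolynomial q).contDiff

theorem affine_dvd_of_contDiff_ite {σ : Type*} [Fintype σ] {k : ℕ} {a : σ → ℝ} (b : ℝ)
    (ha : a ≠ 0) (q : MvPolynomial σ ℝ)
    (h : ContDiff ℝ k (fun p : σ → ℝ =>
      if 0 < (∑ i, a i * p i) + b then ((∑ i, a i * p i) + b) ^ k * eval p q else 0)) :
    ((∑ i, C (a i) * X i) + C b) ∣ q := by
  refine affine_dvd_of_eval_eq_zero b ha q fun p hp => ?_
  have hc : 0 < ∑ i, a i * a i := by
    obtain ⟨j, hj⟩ := Function.ne_iff.1 ha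
    exact Finset.sum_pos' (fun i _ => mul_self_nonneg _)
      ⟨j, Finset.mem_univ j, mul_self_pos.2 hj⟩
  set c := ∑ i, a i * a i
  let γ : ℝ → σ → ℝ := fun t i => p i + c⁻¹ * t * a i
  have hγ : ContDiff ℝ k γ := by
    rw [contDiff_pi]
    intro i
    fun_prop
  have hℓγ : ∀ t, (∑ i, a i * γ t i) + b = t := by
    intro t
    have : ∑ i, a i * γ t i = (∑ i, a i * p i) + c⁻¹ * t * c := by
      simp only [γ, c, Finset.mul_sum, ← Finset.sum_add_distrib]
      exact Finset.sum_congr rfl fun i _ => by ring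
    rw [this, mul_right_comm, inv_mul_cancel₀ hc.ne']
    linarith
  have hcomp := h.comp hγ
  simp only [Function.comp_def, hℓγ] at hcomp
  have hcont : Continuous fun t => eval (γ t) q :=
    (contDiff_eval_s7 q (m := 0)).continuous.comp hγ.continuous
  simpa [γ] using eq_zero_of_contDiff_ite_pow_mul hcont.continuousAt hcomp

/-- **Smoothness criterion across a hyperplane** (underlying the Billera–Rose description of
spline modules): let `ℓ(x) = Σ a_i x_i + b` be a nonzero affine-linear function on `ℝ^n` and
let `f, g` be polynomials. The function `F` equal to `f` on `{ℓ > 0}` and to `g` on `{ℓ ≤ 0}`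
is `r` times continuously differentiable on `ℝ^n` if and only if `ℓ^{r+1}` divides `f - g` in
`ℝ[x_1, …, x_n]`. -/
theorem contDiff_piecewise_iff_pow_dvd (n r : ℕ) (a : Fin n → ℝ) (b : ℝ) (ha : a ≠ 0)
    (f g : MvPolynomial (Fin n) ℝ) :
    ContDiff ℝ r (fun p : Fin n → ℝ =>
        if 0 < (∑ i, a i * p i) + b then eval p f else eval p g) ↔
      ((∑ i, C (a i) * X i) + C b) ^ (r + 1) ∣ f - g := by
  set ℓ : MvPolynomial (Fin n) ℝ := (∑ i, C (a i) * X i) + C b with hℓ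
  have heval : ∀ p : Fin n → ℝ, eval p ℓ = (∑ i, a i * p i) + b := fun p => by simp [hℓ]
  constructor
  · intro h
    have hdiff := h.sub (contDiff_eval_s7 g)
    have hpow : ∀ k ≤ r + 1, ℓ ^ k ∣ f - g := by
      intro k
      induction k with
      | zero => simp
      | succ k ih =>
        intro hk
        obtain ⟨q, hq⟩ := ih (by omega)
        rw [hq, pow_succ]
        refine mul_dvd_mul_left _ (affine_dvd_of_contDiff_ite (k := k) b ha q ?_)
        have hkr : (k : WithTop ℕ∞) ≤ r := by exact_mod_cast Nat.le_of_succ_le_succ hk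
        convert hdiff.of_le hkr using 2 with p
        have hp := congrArg (eval p) hq
        rw [map_sub, map_mul, map_pow, heval] at hp
        split_ifs
        · exact hp.symm
        · simp
    exact hpow (r + 1) le_rfl
  · rintro ⟨q, hq⟩
    have hℓ_smooth : ContDiff ℝ r (fun p : Fin n → ℝ => (∑ i, a i * p i) + b) := by fun_prop
    convert (contDiff_eval_s7 g).add
      (((contDiff_max_zero_pow r).comp hℓ_smooth).mul (contDiff_eval_s7 q)) using 2 with p
    have hp := congrArg (eval p) hq
    rw [map_sub, map_mul, map_pow, heval] at hp
    simp only [Function.comp_apply]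
    split_ifs with hpos
    · rw [max_eq_left hpos.le, ← hp]
      ring
    · simp [max_eq_right (not_lt.1 hpos)]
end
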